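/- arXiv:1603.01371 — 2 statements merged into one kernel-verified Lean document; each statement's English description precedes it below -/
import Mathlib

section
/- Let k ≥ 2 and let G be a k-connected finite graph such that for every k+1 mutually remote edges e₀, e₁, …, e_k of G, the sum d(e₀) + d(e₁) + ⋯ + d(e_k) > (1/2)·k·(|V(G)| − k). Then G contains an edge-dominating cycle. -/
open SimpleGraph Finset

variable {V : Type*}

/-- `G` is `β`-tough: whenever removing a vertex set `S` leaves at least two connected
components, we have `β * (number of components) ≤ |S|`. -/
def IsTough [Fintype V] (β : ℝ) (G : SimpleGraph V) : Prop :=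
  ∀ S : Finset V,
    2 ≤ Nat.card (G.induce ((S : Set V)ᶜ)).ConnectedComponent →
    β * Nat.card (G.induce ((S : Set V)ᶜ)).ConnectedComponent ≤ S.card

/-- A chord of a closed walk `c` in `G`: an edge of `G` between two vertices of `c`
which is not an edge of `c` (hence joins non-consecutive vertices of a cycle). -/
def HasChord (G : SimpleGraph V) {u : V} (c : G.Walk u u) : Prop :=
  ∃ x y : V, x ∈ c.support ∧ y ∈ c.support ∧ G.Adj x y ∧ s(x, y) ∉ c.edges

/-- `G` is 5-chordal: every cycle of length at least 5 has a chord. -/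
def FiveChordal (G : SimpleGraph V) : Prop :=
  ∀ (u : V) (c : G.Walk u u), c.IsCycle → 5 ≤ c.length → HasChord G c

/-- A cycle `c` is edge-dominating in `G` if the induced subgraph on the vertices
outside of `c` contains no edge. -/
def IsEdgeDominating (G : SimpleGraph V) {u : V} (c : G.Walk u u) : Prop :=
  ∀ x y : V, x ∉ c.support → y ∉ c.support → ¬ G.Adj x y

/-- `G` is prism-Hamiltonian if the Cartesian (box) product of `G` with `K₂`
has a Hamiltonian cycle. -/
def PrismHamiltonian [Fintype V] [DecidableEq V] (G : SimpleGraph V) : Prop :=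
  (G □ (⊤ : SimpleGraph (Fin 2))).IsHamiltonian

/-- `G` is `k`-connected: `G` has more than `k` vertices and removing any set of
fewer than `k` vertices leaves a connected graph. -/
def KConnected [Fintype V] (k : ℕ) (G : SimpleGraph V) : Prop :=
  k < Fintype.card V ∧
    ∀ S : Finset V, S.card < k → (G.induce ((S : Set V)ᶜ)).Connected

/-- The degree `d(e)` of an edge `e = uv`: the number of vertices other than `u, v`
adjacent to `u` or `v`. -/
noncomputable def edgeDeg (G : SimpleGraph V) (u v : V) : ℕ :=
  ((G.neighborSet u ∪ G.neighborSet v) \ {u, v}).ncard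

/-- Two edges (given by their endpoints) are remote: they are vertex-disjoint and
no edge of `G` joins an endpoint of one to an endpoint of the other. -/
def Remote (G : SimpleGraph V) (e₁ e₂ : V × V) : Prop :=
  e₁.1 ≠ e₂.1 ∧ e₁.1 ≠ e₂.2 ∧ e₁.2 ≠ e₂.1 ∧ e₁.2 ≠ e₂.2 ∧
  ¬ G.Adj e₁.1 e₂.1 ∧ ¬ G.Adj e₁.1 e₂.2 ∧ ¬ G.Adj e₁.2 e₂.1 ∧ ¬ G.Adj e₁.2 e₂.2

namespace EdgeDominating

open List (IsRotated)

/-- The vertex list of a cycle of `G`, read off from an arbitrary starting vertex. -/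
structure IsCyclicList (G : SimpleGraph V) (l : List V) : Prop where
  nodup : l.Nodup
  three_le : 3 ≤ l.length
  chain : l.IsChain G.Adj
  closing : ∀ x ∈ l.getLast?, ∀ y ∈ l.head?, G.Adj x y

lemma IsCyclicList.rotated {G : SimpleGraph V} {l l' : List V} (h : IsCyclicList G l)
    (hr : l ~r l') : IsCyclicList G l' := by
  obtain ⟨n, hn, rfl⟩ := List.isRotated_iff_mod.mp hr
  have h1 := h.chain
  have h2 := h.closing
  refine ⟨by simpa using h.nodup, by simpa using h.three_le, ?_, ?_⟩ <;>
    rw [List.rotate_eq_drop_append_take hn] <;>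
    rw [← List.take_append_drop n l] at h1 h2 <;>
    generalize List.take n l = a at * <;> generalize List.drop n l = b at * <;>
    rw [List.isChain_append] at * <;>
    rw [List.getLast?_append, List.head?_append] at * <;>
    rcases List.eq_nil_or_concat a with rfl | ⟨a, z, rfl⟩ <;>
    rcases List.eq_nil_or_concat b with rfl | ⟨b, w, rfl⟩ <;> simp_all

lemma eq_of_isRotated_of_head {l l' : List V} (hl : l.Nodup) (h : l ~r l')
    (hh : l.head? = l'.head?) : l = l' := by
  obtain ⟨n, hn, rfl⟩ := List.isRotated_iff_mod.mp h
  rw [List.rotate_eq_drop_append_take hn] at *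
  conv_lhs => rw [← List.take_append_drop n l]
  rw [← List.take_append_drop n l] at hl
  conv at hh => lhs; rw [← List.take_append_drop n l]
  generalize List.take n l = a at *
  generalize List.drop n l = b at *
  cases a <;> cases b <;> grind

lemma eq_of_isRotated_of_getLast {l l' : List V} (hl : l.Nodup) (h : l ~r l')
    (hh : l.getLast? = l'.getLast?) : l = l' := by
  rw [← List.reverse_inj]
  exact eq_of_isRotated_of_head (by simpa using hl) h.reverse (by simpa using hh)

lemma exists_isRotated_getLast {l : List V} {v : V} (hv : v ∈ l) :
    ∃ l', l ~r l' ∧ l'.getLast? = some v := by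
  obtain ⟨s, t, rfl⟩ := List.append_of_mem hv
  refine ⟨t ++ (s ++ [v]), ?_, by simp⟩
  have := List.isRotated_append (l := s ++ [v]) (l' := t)
  simpa using this

lemma IsCyclicList.exists_isCycle {G : SimpleGraph V} {l : List V} (h : IsCyclicList G l) :
    ∃ (u : V) (c : G.Walk u u), c.IsCycle ∧ ∀ x, x ∈ c.support ↔ x ∈ l := by
  obtain ⟨hn, h3, hc, hcl⟩ := h
  match l, hn, h3, hc, hcl with
  | x :: y :: t, hn, h3, hc, hcl =>
    have hch : (x :: y :: (t ++ [x])).IsChain G.Adj := by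
      have : ((x :: y :: t) ++ [x]).IsChain G.Adj := by
        rw [List.isChain_append]
        exact ⟨hc, by simp, by simpa using hcl⟩
      simpa using this
    let c : G.Walk x x := (Walk.ofSupport _ (by simp) hch).copy rfl (by simp)
    have hs : c.support = x :: y :: (t ++ [x]) :=
      (Walk.support_copy ..).trans (Walk.support_ofSupport ..)
    refine ⟨x, c, ?_, fun z => by rw [hs]; grind⟩
    have hl : c.length = t.length + 2 := by
      have := c.length_support
      rw [hs] at this
      simp at this
      omega
    rw [Walk.isCycle_iff_isPath_tail_and_le_length, Walk.isPath_def]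
    refine ⟨?_, by simp at h3; omega⟩
    rw [Walk.support_tail_of_not_nil _ (by rw [Walk.not_nil_iff_lt_length]; omega), hs]
    simp only [List.tail_cons, List.nodup_cons, List.nodup_append] at hn ⊢
    grind

lemma exists_isCyclicList {G : SimpleGraph V} {u : V} {c : G.Walk u u} (h : c.IsCycle) :
    ∃ l, IsCyclicList G l := by
  refine ⟨c.support.tail, h.support_nodup, by simpa using h.three_le_length,
    c.isChain_adj_support.tail, ?_⟩
  cases c with
  | nil => simp at h
  | cons h' p =>
    have h1 := p.support_ne_nil
    have h2 : p.support.getLast? = some u := by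
      rw [List.getLast?_eq_some_getLast h1]; simp
    have h3 := p.head_support
    have h4 := List.head?_eq_some_head h1
    simp [h2, h4, h']

/-- `H` is a connected set of vertices off the cycle `C`, closed under adjacency off `C`, and every
cycle meeting `H` omits a vertex of `C` together with one of its neighbours. -/
structure OffComponent (G : SimpleGraph V) (C : List V) (H : Set V) : Prop where
  cyclic : IsCyclicList G C
  disjoint : ∀ h ∈ H, h ∉ C
  closed : ∀ h ∈ H, ∀ z, G.Adj h z → z ∈ C ∨ z ∈ H
  path : ∀ h ∈ H, ∀ h' ∈ H, ∃ Q : List V, Q.Nodup ∧ Q.IsChain G.Adj ∧ Q.head? = some h ∧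
    Q.getLast? = some h' ∧ ∀ x ∈ Q, x ∈ H
  unimprovable : ∀ C', IsCyclicList G C' → (∃ h ∈ C', h ∈ H) →
    ∃ a ∈ C, a ∉ C' ∧ ∃ z, G.Adj a z ∧ z ∉ C'

/-- `v` is a vertex of `C` with a neighbour in `H`. -/
def Attached (G : SimpleGraph V) (C : List V) (H : Set V) (v : V) : Prop :=
  v ∈ C ∧ ∃ h ∈ H, G.Adj v h

/-- The list `X` starts at `p`, and `q` is a neighbour of `p` off `C` or, if `p` has no such
neighbour, the second entry of `X`. -/
def IsStart (G : SimpleGraph V) (C : List V) (p q : V) (X : List V) : Prop :=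
  ∃ t, X = p :: t ∧ (q ∉ C ∧ G.Adj p q ∨ (∀ z, G.Adj p z → z ∈ C) ∧ t.head? = some q)

/-- `pq` is an edge picked right after `v` on `C`: `p` is the successor of `v`, and `q` is a
neighbour of `p` off `C` or, if there is none, the successor of `p`. -/
def IsMark (G : SimpleGraph V) (C : List V) (v p q : V) : Prop :=
  ∃ X, C ~r X ∧ X.getLast? = some v ∧ IsStart G C p q X

variable {G : SimpleGraph V} {C : List V} {H : Set V}

lemma OffComponent.exists_omitted (O : OffComponent G C H) {P : List V} {x y : V}
    (hn : P.Nodup) (hch : P.IsChain G.Adj) (h2 : 2 ≤ P.length) (hH : ∀ z ∈ P, z ∉ H)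
    (hx : P.head? = some x) (hy : P.getLast? = some y)
    (ax : Attached G C H x) (ay : Attached G C H y) :
    ∃ a ∈ C, a ∉ P ∧ ∃ z, G.Adj a z ∧ z ∉ P := by
  obtain ⟨-, h, hh, hxh⟩ := ax
  obtain ⟨-, h', hh', hyh⟩ := ay
  obtain ⟨Q, Qn, Qc, Qh, Ql, QH⟩ := O.path h' hh' h hh
  have hQ : Q ≠ [] := by rintro rfl; simp at Qh
  have hP : P ≠ [] := by rintro rfl; simp at hx
  have hcyc : IsCyclicList G (P ++ Q) := by
    refine ⟨?_, ?_, ?_, ?_⟩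
    · rw [List.nodup_append]
      exact ⟨hn, Qn, fun a ha b hb e => hH a ha (e ▸ QH b hb)⟩
    · have := List.length_pos_of_ne_nil hQ
      rw [List.length_append]; omega
    · rw [List.isChain_append]
      refine ⟨hch, Qc, ?_⟩
      simp [hy, Qh, hyh]
    · simp [List.getLast?_append, List.head?_append, Ql, hx, hxh.symm]
  obtain ⟨a, haC, haP, z, haz, hz⟩ := O.unimprovable _ hcyc
    ⟨h, List.mem_append_right _ (List.mem_of_getLast? Ql), hh⟩
  rw [List.mem_append, not_or] at haP hz
  exact ⟨a, haC, haP.1, z, haz, hz.1⟩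

lemma OffComponent.not_mem (O : OffComponent G C H) {X : List V} (hX : C ~r X) :
    ∀ z ∈ X, z ∉ H := fun z hz hH => O.disjoint z hH (hX.mem_iff.mpr hz)

lemma OffComponent.not_attached_left (O : OffComponent G C H) {v p q : V}
    (hv : Attached G C H v) (h : IsMark G C v p q) : ¬ Attached G C H p := by
  intro hp
  obtain ⟨X, hX, hl, t, rfl, -⟩ := h
  have hc := O.cyclic.rotated hX
  obtain ⟨a, haC, haX, -⟩ := O.exists_omitted hc.nodup hc.chain (by have := hc.three_le; omega)
    (O.not_mem hX) (by simp) hl hp hv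
  exact haX (hX.mem_iff.mp haC)

lemma OffComponent.not_attached_right (O : OffComponent G C H) {v p q : V}
    (hv : Attached G C H v) (h : IsMark G C v p q) : ¬ Attached G C H q := by
  intro hq
  obtain ⟨X, hX, hl, t, rfl, hqC | ⟨hpC, ht⟩⟩ := h
  · exact hqC.1 hq.1
  have hc := O.cyclic.rotated hX
  have h3 := hc.three_le
  have hl' : t.getLast? = some v := by
    cases t <;> simp_all
  obtain ⟨a, haC, hat, z, haz, hz⟩ := O.exists_omitted hc.nodup.of_cons hc.chain.tail
    (by simp at h3 ⊢; omega) (fun z hz => O.not_mem hX z (List.mem_cons_of_mem _ hz)) ht hl' hq hv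
  have hap : a = p := by
    have := hX.mem_iff.mp haC
    simp_all
  subst hap
  have hzC := hX.mem_iff.mp (hpC z haz)
  have := haz.ne
  simp_all

lemma OffComponent.far_left (O : OffComponent G C H) {v p q : V}
    (hv : Attached G C H v) (h : IsMark G C v p q) : p ∉ H ∧ ∀ h ∈ H, ¬ G.Adj p h := by
  have hp : p ∈ C := by
    obtain ⟨X, hX, hl, t, rfl, -⟩ := h
    exact hX.mem_iff.mpr (by simp)
  exact ⟨fun hH => O.disjoint p hH hp, fun w hw hpw => O.not_attached_left hv h ⟨hp, w, hw, hpw⟩⟩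

lemma OffComponent.far_right (O : OffComponent G C H) {v p q : V}
    (hv : Attached G C H v) (h : IsMark G C v p q) : q ∉ H ∧ ∀ h ∈ H, ¬ G.Adj q h := by
  by_cases hq : q ∈ C
  · exact ⟨fun hH => O.disjoint q hH hq,
      fun w hw hpw => O.not_attached_right hv h ⟨hq, w, hw, hpw⟩⟩
  have hpq : G.Adj p q := by
    obtain ⟨X, hX, hl, t, rfl, hqC | ⟨hpC, ht⟩⟩ := h
    · exact hqC.2
    · exact absurd (hX.mem_iff.mpr (List.mem_cons_of_mem _ (List.mem_of_mem_head? ht))) hq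
  have hqH : q ∉ H := fun hH => (O.far_left hv h).2 q hH hpq
  exact ⟨hqH, fun w hw hqw => (O.closed w hw q hqw.symm).elim hq hqH⟩

lemma exists_isMark (hC : IsCyclicList G C) {v : V} (hv : v ∈ C) : ∃ p q, IsMark G C v p q := by
  obtain ⟨X, hX, hl⟩ := exists_isRotated_getLast hv
  have h3 := (hC.rotated hX).three_le
  match X, h3 with
  | p :: q :: t, _ =>
    by_cases h : ∃ w, w ∉ C ∧ G.Adj p w
    · obtain ⟨w, hw⟩ := h
      exact ⟨p, w, _, hX, hl, _, rfl, .inl hw⟩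
    · push Not at h
      exact ⟨p, q, _, hX, hl, _, rfl, .inr ⟨fun z hz => by_contra fun hc => h z hc hz, rfl⟩⟩

lemma IsMark.adj (hC : IsCyclicList G C) {v p q : V} (h : IsMark G C v p q) : G.Adj p q := by
  obtain ⟨X, hX, hl, t, rfl, hqC | ⟨hpC, ht⟩⟩ := h
  · exact hqC.2
  · have := (hC.rotated hX).chain
    cases t <;> simp_all

lemma IsStart.of_append {p q u : V} {A B : List V} (h : IsStart G C p q (A ++ B))
    (hA : A.getLast? = some u) (hp : u ≠ p) : IsStart G C p q A := by
  obtain ⟨t, ht, h⟩ := h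
  match A, hA with
  | a :: s, hA =>
    obtain ⟨rfl, rfl⟩ : a = p ∧ s ++ B = t := by simpa using ht
    refine ⟨s, rfl, ?_⟩
    cases s <;> simp_all

/-- Two marks at distinct attached vertices split the cycle into two arcs. -/
lemma OffComponent.exists_arcs (O : OffComponent G C H) {v p q v' p' q' : V}
    (hv : Attached G C H v) (h : IsMark G C v p q)
    (hv' : Attached G C H v') (h' : IsMark G C v' p' q') (hne : v ≠ v') :
    ∃ X Y, C ~r X ++ Y ∧ X.getLast? = some v' ∧ Y.getLast? = some v ∧
      IsStart G C p q X ∧ IsStart G C p' q' Y := by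
  have hpv := O.not_attached_left hv h
  have hpv' := O.not_attached_left hv' h'
  obtain ⟨L, hL, hl, hs⟩ := h
  obtain ⟨L', hL', hl', hs'⟩ := h'
  obtain ⟨s, t, rfl⟩ := List.append_of_mem (hL.mem_iff.mp hv'.1)
  have ht : t.getLast? = some v := by
    rcases List.eq_nil_or_concat t with rfl | ⟨t, z, rfl⟩
    · simp_all
    · rw [show s ++ v' :: (t.concat z) = (s ++ v' :: t) ++ [z] by simp, List.getLast?_concat] at hl
      simpa using hl
  have e : s ++ v' :: t = (s ++ [v']) ++ t := by simp
  rw [e] at hL hs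
  have e' : L' = t ++ (s ++ [v']) :=
    eq_of_isRotated_of_getLast (hL'.nodup_iff.mp O.cyclic.nodup)
      (hL'.symm.trans (hL.trans List.isRotated_append)) (by simpa using hl')
  subst e'
  refine ⟨s ++ [v'], t, hL, by simp, ht, hs.of_append (u := v') (by simp) ?_,
    hs'.of_append (u := v) ht ?_⟩
  · rintro rfl; exact hpv hv'
  · rintro rfl; exact hpv' hv

/-- `W` is a path that starts at `x`, an endpoint of `pq`, and follows `X` to its end; it omits at
most `p`, and only when `p` has no neighbour off `C`. -/
structure IsEntry (G : SimpleGraph V) (C : List V) (p q : V) (X : List V) (x : V) (W : List V) :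
    Prop where
  chain : W.IsChain G.Adj
  nodup : W.Nodup
  head : W.head? = some x
  last : W.getLast? = X.getLast?
  mem : ∀ a ∈ W, a ∈ X ∨ a = q ∧ a ∉ C
  cover : ∀ a ∈ X, a ∉ W → a = p ∧ ∀ z, G.Adj a z → z ∈ C

lemma IsStart.isEntry {p q : V} {X : List V} (hs : IsStart G C p q X)
    (hX : X.IsChain G.Adj) (hn : X.Nodup) : IsEntry G C p q X p X := by
  obtain ⟨t, rfl, -⟩ := hs
  exact ⟨hX, hn, rfl, rfl, fun a ha => .inl ha, fun a ha h => absurd ha h⟩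

lemma IsStart.exists_isEntry {p q x : V} {X : List V} (hs : IsStart G C p q X)
    (hX : X.IsChain G.Adj) (hn : X.Nodup) (hXC : ∀ a ∈ X, a ∈ C) (hx : x = p ∨ x = q) :
    ∃ W, IsEntry G C p q X x W := by
  rcases hx with rfl | rfl
  · exact ⟨X, hs.isEntry hX hn⟩
  obtain ⟨t, rfl, ⟨hq, hpq⟩ | ⟨hpC, ht⟩⟩ := hs
  · refine ⟨x :: p :: t, ⟨?_, ?_, rfl, by simp, by simp +contextual [hq], by simp; tauto⟩⟩
    · simp [List.isChain_cons_cons, hpq.symm, hX]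
    · exact List.nodup_cons.mpr ⟨fun h => hq (hXC _ h), hn⟩
  · refine ⟨t, ⟨hX.tail, hn.of_cons, ht, ?_, by simp +contextual, ?_⟩⟩
    · cases t <;> simp_all
    · intro a ha hat
      obtain rfl : a = p := by simpa [hat] using ha
      exact ⟨rfl, hpC⟩

/-- Two arcs that make up the cycle `C`, each ending at a vertex attached to `H` and starting at a
marked edge. -/
structure IsArcPair (G : SimpleGraph V) (C : List V) (H : Set V) (p q : V) (X : List V)
    (p' q' : V) (Y : List V) : Prop where
  rot : C ~r X ++ Y
  last : ∃ v, X.getLast? = some v ∧ Attached G C H v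
  last' : ∃ v, Y.getLast? = some v ∧ Attached G C H v
  start : IsStart G C p q X
  start' : IsStart G C p' q' Y
  not_mem : q ∉ H
  not_mem' : q' ∉ H

namespace IsArcPair

variable {p q p' q' : V} {X Y : List V}

lemma swap (A : IsArcPair G C H p q X p' q' Y) : IsArcPair G C H p' q' Y p q X :=
  ⟨A.rot.trans List.isRotated_append, A.last', A.last, A.start', A.start, A.not_mem', A.not_mem⟩

lemma mem_iff (A : IsArcPair G C H p q X p' q' Y) {a : V} : a ∈ C ↔ a ∈ X ∨ a ∈ Y := by
  rw [A.rot.mem_iff, List.mem_append]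

lemma left_mem (A : IsArcPair G C H p q X p' q' Y) : p ∈ X := by
  obtain ⟨t, rfl, -⟩ := A.start
  simp

lemma right_mem (A : IsArcPair G C H p q X p' q' Y) (hq : q ∈ C) : q ∈ X := by
  obtain ⟨t, rfl, h | h⟩ := A.start
  · exact absurd hq h.1
  · exact List.mem_cons_of_mem _ (List.mem_of_mem_head? h.2)

lemma nodup (A : IsArcPair G C H p q X p' q' Y) (O : OffComponent G C H) :
    X.Nodup ∧ Y.Nodup ∧ ∀ a ∈ X, a ∉ Y := by
  have := (O.cyclic.rotated A.rot).nodup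
  rw [List.nodup_append'] at this
  exact this

lemma chain (A : IsArcPair G C H p q X p' q' Y) (O : OffComponent G C H) : X.IsChain G.Adj :=
  (O.cyclic.rotated A.rot).chain.left_of_append

lemma entry_disjoint (A : IsArcPair G C H p q X p' q' Y) (O : OffComponent G C H)
    (hq : q ∉ C → q ≠ q') {x y : V} {W W' : List V} (hW : IsEntry G C p q X x W)
    (hW' : IsEntry G C p' q' Y y W') : ∀ a ∈ W, a ∉ W' := by
  intro a ha ha'
  have hd := (A.nodup O).2.2 a
  have hm := A.mem_iff (a := a)
  rcases hW.mem a ha with h | ⟨rfl, h⟩ <;> rcases hW'.mem a ha' with h' | ⟨rfl, h'⟩ <;> simp_all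

lemma entry_not_mem (A : IsArcPair G C H p q X p' q' Y) (O : OffComponent G C H)
    {x : V} {W : List V} (hW : IsEntry G C p q X x W) : ∀ a ∈ W, a ∉ H := by
  intro a ha haH
  rcases hW.mem a ha with h | ⟨rfl, h⟩
  · exact O.disjoint a haH (A.mem_iff.mpr (.inl h))
  · exact A.not_mem haH

lemma exists_entry (A : IsArcPair G C H p q X p' q' Y) (O : OffComponent G C H) {x : V}
    (hx : x = p ∨ x = q) : ∃ W, IsEntry G C p q X x W :=
  A.start.exists_isEntry (A.chain O) (A.nodup O).1 (fun _ ha => A.mem_iff.mpr (.inl ha)) hx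

lemma isChain_reverse_adj {l : List V} : l.reverse.IsChain G.Adj ↔ l.IsChain G.Adj := by
  simp [List.isChain_reverse, G.adj_comm]

lemma false_of_bridge (A : IsArcPair G C H p q X p' q' Y) (O : OffComponent G C H)
    {x y : V} {W W' R : List V} (hW : IsEntry G C p q X x W) (hW' : IsEntry G C p' q' Y y W')
    (hch : (W.reverse ++ (R ++ W')).IsChain G.Adj) (hR : R.Nodup)
    (hRH : ∀ a ∈ R, a ∉ H) (hRW : ∀ a ∈ R, a ∉ W) (hRW' : ∀ a ∈ R, a ∉ W')
    (hWW : ∀ a ∈ W, a ∉ W')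
    (hpp : (∀ a ∈ X, a ∈ W) ∧ (∀ a ∈ Y, a ∈ W') ∨ ¬ G.Adj p p') : False := by
  obtain ⟨v, hv, av⟩ := A.last
  obtain ⟨v', hv', av'⟩ := A.last'
  have hne : W ≠ [] := by rintro rfl; simpa using hW.head
  have hne' : W' ≠ [] := by rintro rfl; simpa using hW'.head
  have hn : (W.reverse ++ (R ++ W')).Nodup := by
    have := hW.nodup
    have := hW'.nodup
    simp only [List.nodup_append', List.nodup_reverse, List.disjoint_left, List.mem_append,
      List.mem_reverse]
    grind
  have h2 : 2 ≤ (W.reverse ++ (R ++ W')).length := by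
    have := List.length_pos_of_ne_nil hne
    have := List.length_pos_of_ne_nil hne'
    simp; omega
  have hH : ∀ a ∈ W.reverse ++ (R ++ W'), a ∉ H := by
    intro a ha
    simp only [List.mem_append, List.mem_reverse] at ha
    rcases ha with h | h | h
    · exact A.entry_not_mem O hW a h
    · exact hRH a h
    · exact A.swap.entry_not_mem O hW' a h
  obtain ⟨a, haC, haP, z, haz, hz⟩ := O.exists_omitted hn hch h2 hH
    (by simp [List.head?_append, hW.last, hv]) (by simp [List.getLast?_append, hW'.last, hv'])
    av av'
  simp only [List.mem_append, List.mem_reverse, not_or] at haP hz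
  have key : ∀ b ∈ C, b ∉ W → b ∉ W' → (b = p ∨ b = p') ∧ ∀ z, G.Adj b z → z ∈ C := by
    intro b hb h1 h2
    rcases A.mem_iff.mp hb with h | h
    · exact ⟨.inl (hW.cover b h h1).1, (hW.cover b h h1).2⟩
    · exact ⟨.inr (hW'.cover b h h2).1, (hW'.cover b h h2).2⟩
  rcases hpp with ⟨h1, h2⟩ | hpp
  · exact (A.mem_iff.mp haC).elim (fun h => haP.1 (h1 a h)) fun h => haP.2.2 (h2 a h)
  obtain ⟨ha, haC⟩ := key a haC haP.1 haP.2.2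
  obtain ⟨hb, -⟩ := key z (haC z haz) hz.1 hz.2.2
  rcases ha with rfl | rfl <;> rcases hb with rfl | rfl
  · exact haz.ne rfl
  · exact hpp haz
  · exact hpp haz.symm
  · exact haz.ne rfl

lemma not_adj_left (A : IsArcPair G C H p q X p' q' Y) (O : OffComponent G C H) :
    ¬ G.Adj p p' := by
  intro h
  have hW := A.start.isEntry (A.chain O) (A.nodup O).1
  have hW' := A.swap.start.isEntry (A.swap.chain O) (A.nodup O).2.1
  refine A.false_of_bridge O (R := []) hW hW' ?_ (by simp) (by simp) (by simp) (by simp)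
    (A.nodup O).2.2 (.inl ⟨fun _ => id, fun _ => id⟩)
  simp [List.isChain_append, isChain_reverse_adj, hW.chain, hW'.chain, hW.head, hW'.head, h]

lemma right_ne (A : IsArcPair G C H p q X p' q' Y) (O : OffComponent G C H)
    (hpq : G.Adj p q) (hpq' : G.Adj p' q') : q ≠ q' := by
  rintro rfl
  by_cases hq : q ∈ C
  · exact (A.nodup O).2.2 q (A.right_mem hq) (A.swap.right_mem hq)
  have hW := A.start.isEntry (A.chain O) (A.nodup O).1
  have hW' := A.swap.start.isEntry (A.swap.chain O) (A.nodup O).2.1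
  rw [A.mem_iff, not_or] at hq
  refine A.false_of_bridge O (R := [q]) hW hW' ?_ (by simp) (by simpa using A.not_mem)
    (by simp [hq]) (by simp [hq]) (A.nodup O).2.2 (.inl ⟨fun _ => id, fun _ => id⟩)
  simp [List.isChain_append, List.isChain_cons, isChain_reverse_adj, hW.chain, hW'.chain, hW.head,
    hW'.head, hpq, hpq'.symm]

lemma not_adj (A : IsArcPair G C H p q X p' q' Y) (O : OffComponent G C H) (hq : q ≠ q')
    {x y : V} (hx : x = p ∨ x = q) (hy : y = p' ∨ y = q') : ¬ G.Adj x y := by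
  intro h
  obtain ⟨W, hW⟩ := A.exists_entry O hx
  obtain ⟨W', hW'⟩ := A.swap.exists_entry O hy
  refine A.false_of_bridge O (R := []) hW hW' ?_ (by simp) (by simp) (by simp) (by simp)
    (A.entry_disjoint O (fun _ => hq) hW hW') (.inr (A.not_adj_left O))
  simp [List.isChain_append, isChain_reverse_adj, hW.chain, hW'.chain, hW.head, hW'.head, h]

lemma remote (A : IsArcPair G C H p q X p' q' Y) (O : OffComponent G C H)
    (hpq : G.Adj p q) (hpq' : G.Adj p' q') : Remote G (p, q) (p', q') := by
  have hd := (A.nodup O).2.2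
  have hq := A.right_ne O hpq hpq'
  refine ⟨?_, ?_, ?_, hq, A.not_adj O hq (.inl rfl) (.inl rfl),
    A.not_adj O hq (.inl rfl) (.inr rfl), A.not_adj O hq (.inr rfl) (.inl rfl),
    A.not_adj O hq (.inr rfl) (.inr rfl)⟩
  · rintro (rfl : p = p')
    exact hd p A.left_mem A.swap.left_mem
  · rintro (rfl : p = q')
    exact hd p A.left_mem (A.swap.right_mem (A.mem_iff.mpr (.inl A.left_mem)))
  · rintro (rfl : q = p')
    exact hd q (A.right_mem (A.mem_iff.mpr (.inr A.swap.left_mem))) A.swap.left_mem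

/-- The marked edges of an arc pair have no common neighbour off `C`. -/
lemma no_common_neighbor (A : IsArcPair G C H p q X p' q' Y) (O : OffComponent G C H) (hq : q ≠ q')
    {x y z : V} (hx : x = p ∨ x = q) (hy : y = p' ∨ y = q') (hxz : G.Adj x z) (hyz : G.Adj y z)
    (hzC : z ∉ C) (hzH : z ∉ H) (hzq : z ≠ q) (hzq' : z ≠ q') : False := by
  obtain ⟨W, hW⟩ := A.exists_entry O hx
  obtain ⟨W', hW'⟩ := A.swap.exists_entry O hy
  have hz := hzC
  rw [A.mem_iff, not_or] at hz
  refine A.false_of_bridge O (R := [z]) hW hW' ?_ (by simp) (by simpa using hzH) ?_ ?_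
    (A.entry_disjoint O (fun _ => hq) hW hW') (.inr (A.not_adj_left O))
  · simp [List.isChain_append, List.isChain_cons, isChain_reverse_adj, hW.chain, hW'.chain, hW.head,
      hW'.head, hxz, hyz.symm]
  · simp only [List.mem_singleton, forall_eq]
    intro h
    have := hW.mem z h
    tauto
  · simp only [List.mem_singleton, forall_eq]
    intro h
    have := hW'.mem z h
    tauto

/-- If `z` follows `y` on the first arc, then `z` is not adjacent to the first marked edge or `y` is
not adjacent to the second. -/
lemma no_shifted_neighbor (A : IsArcPair G C H p q X p' q' Y) (O : OffComponent G C H)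
    (hq : q ≠ q') {x x' y z : V} {X₁ X₂ : List V} (hX : X = X₁ ++ y :: z :: X₂)
    (hx : x = p ∨ x = q) (hx' : x' = p' ∨ x' = q') (hxz : G.Adj x z) (hyx : G.Adj x' y)
    (hyp : y ≠ p) : False := by
  obtain ⟨v, hv, av⟩ := A.last
  obtain ⟨v', hv', av'⟩ := A.last'
  obtain ⟨hnX, hnY, hd⟩ := A.nodup O
  have hc := A.chain O
  have e : X = (X₁ ++ [y]) ++ (z :: X₂) := by simp [hX]
  have hst := A.start
  rw [e] at hst hc hnX
  have hl : (z :: X₂).getLast? = some v := by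
    rw [e] at hv
    rw [List.getLast?_append] at hv
    obtain ⟨w, hw⟩ : ∃ w, (z :: X₂).getLast? = some w := by simp [List.getLast?_cons]
    simpa [hw] using hv
  obtain ⟨W, hW⟩ := (hst.of_append (u := y) (by simp) hyp).exists_isEntry hc.left_of_append
    (List.nodup_append'.mp hnX).1 (fun a ha => A.mem_iff.mpr
      (.inl (by rw [e]; exact List.mem_append_left _ ha))) hx
  obtain ⟨W', hW'⟩ := A.swap.exists_entry O hx'
  have hsub : ∀ a, a ∈ X ↔ a ∈ X₁ ++ [y] ∨ a ∈ z :: X₂ := by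
    intro a; rw [e, List.mem_append]
  obtain ⟨hn1, hn2, hn3⟩ := List.nodup_append'.mp hnX
  have hWz : ∀ a ∈ W, a ∉ z :: X₂ := by
    intro a ha ha'
    rcases hW.mem a ha with h | ⟨-, h⟩
    · exact hn3 h ha'
    · exact h (A.mem_iff.mpr (.inl ((hsub a).mpr (.inr ha'))))
  have hWz' : ∀ a ∈ W', a ∉ z :: X₂ := by
    intro a ha ha'
    rcases hW'.mem a ha with h | ⟨-, h⟩
    · exact hd a ((hsub a).mpr (.inr ha')) h
    · exact h (A.mem_iff.mpr (.inl ((hsub a).mpr (.inr ha'))))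
  have hWW : ∀ a ∈ W, a ∉ W' := by
    intro a ha ha'
    rcases hW.mem a ha with h | ⟨rfl, h⟩ <;> rcases hW'.mem a ha' with h' | ⟨rfl, h'⟩
    · exact hd a ((hsub a).mpr (.inl h)) h'
    · exact h' (A.mem_iff.mpr (.inl ((hsub a).mpr (.inl h))))
    · exact h (A.mem_iff.mpr (.inr h'))
    · exact hq rfl
  have hWl : W.getLast? = some y := by rw [hW.last]; simp
  have hn : ((z :: X₂).reverse ++ (W ++ W')).Nodup := by
    simp only [List.nodup_append', List.nodup_reverse, List.disjoint_left, List.mem_append,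
      List.mem_reverse]
    exact ⟨hn2, ⟨hW.nodup, hW'.nodup, hWW⟩,
      fun a ha h => h.elim (fun h => hWz a h ha) fun h => hWz' a h ha⟩
  have hch : ((z :: X₂).reverse ++ (W ++ W')).IsChain G.Adj := by
    have h1 : (z :: X₂).IsChain G.Adj := (List.isChain_append.mp hc).2.1
    rw [List.isChain_append, isChain_reverse_adj, List.isChain_append]
    refine ⟨h1, ⟨hW.chain, hW'.chain, by simp [hWl, hW'.head, hyx.symm]⟩, ?_⟩
    simp [List.head?_append, hW.head, hxz.symm]
  have h2 : 2 ≤ ((z :: X₂).reverse ++ (W ++ W')).length := by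
    have : 0 < W.length := List.length_pos_of_mem (List.mem_of_getLast? hWl)
    simp; omega
  have hH : ∀ a ∈ (z :: X₂).reverse ++ (W ++ W'), a ∉ H := by
    intro a ha
    simp only [List.mem_append, List.mem_reverse] at ha
    rcases ha with h | h | h
    · exact fun hH => O.disjoint a hH (A.mem_iff.mpr (.inl ((hsub a).mpr (.inr h))))
    · intro hH
      rcases hW.mem a h with h | ⟨rfl, h⟩
      · exact O.disjoint a hH (A.mem_iff.mpr (.inl ((hsub a).mpr (.inl h))))
      · exact A.not_mem hH
    · exact A.swap.entry_not_mem O hW' a h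
  obtain ⟨a, haC, haP, b, hab, hb⟩ := O.exists_omitted hn hch h2 hH
    (by rw [List.head?_append, List.head?_reverse, hl]; rfl)
    (by rw [← List.append_assoc, List.getLast?_append, hW'.last, hv']; rfl) av av'
  simp only [List.mem_append, List.mem_reverse, not_or] at haP hb
  have key : ∀ b ∈ C, b ∉ z :: X₂ → b ∉ W → b ∉ W' →
      (b = p ∨ b = p') ∧ ∀ z, G.Adj b z → z ∈ C := by
    intro b hb h0 h1 h2
    rcases A.mem_iff.mp hb with h | h
    · have h := ((hsub b).mp h).resolve_right h0
      exact ⟨.inl (hW.cover b h h1).1, (hW.cover b h h1).2⟩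
    · exact ⟨.inr (hW'.cover b h h2).1, (hW'.cover b h h2).2⟩
  obtain ⟨ha, haC⟩ := key a haC haP.1 haP.2.1 haP.2.2
  obtain ⟨hb, -⟩ := key b (haC b hab) hb.1 hb.2.1 hb.2.2
  rcases ha with rfl | rfl <;> rcases hb with rfl | rfl
  · exact hab.ne rfl
  · exact A.not_adj_left O hab
  · exact A.not_adj_left O hab.symm
  · exact hab.ne rfl

end IsArcPair

open Classical in
lemma countP_add_countP_add_countP_le {R S M : Set V} {a : V} {l : List V}
    (hM : ∀ y ∈ a :: l, y ∈ M → y ∉ S)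
    (hch : (a :: l).IsChain fun y z => z ∈ R → y ∉ S ∧ y ∉ M) (ha : a ∉ R) :
    (a :: l).countP (· ∈ R) + (a :: l).countP (· ∈ S) + (a :: l).countP (· ∈ M) ≤
      (a :: l).length := by
  suffices h : (a :: l).countP (· ∈ R) + (a :: l).countP (· ∈ S) + (a :: l).countP (· ∈ M) ≤
      (a :: l).length + if a ∈ R then 1 else 0 by simpa [ha] using h
  clear ha
  induction l generalizing a with
  | nil =>
    have := hM a (by simp)
    simp only [List.countP_cons, List.countP_nil, List.length_cons, List.length_nil]
    by_cases a ∈ R <;> by_cases a ∈ S <;> by_cases a ∈ M <;> simp_all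
  | cons b l ih =>
    have hb := ih (fun y hy => hM y (List.mem_cons_of_mem _ hy)) hch.tail
    have h1 := (List.isChain_cons_cons.mp hch).1
    have h2 := hM a (by simp)
    rw [List.countP_cons (a := a), List.countP_cons (a := a), List.countP_cons (a := a),
      List.length_cons (a := a)]
    by_cases a ∈ R <;> by_cases a ∈ S <;> by_cases a ∈ M <;> by_cases b ∈ R <;> simp_all <;> omega

/-- The set of vertices counted by `edgeDeg`. -/
def edgeNbrs (G : SimpleGraph V) (p q : V) : Set V :=
  (G.neighborSet p ∪ G.neighborSet q) \ {p, q}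

lemma mem_edgeNbrs {p q z : V} :
    z ∈ edgeNbrs G p q ↔ (G.Adj p z ∨ G.Adj q z) ∧ z ≠ p ∧ z ≠ q := by
  simp [edgeNbrs]

lemma exists_adj_of_mem_edgeNbrs {p q z : V} (h : z ∈ edgeNbrs G p q) :
    ∃ x, (x = p ∨ x = q) ∧ G.Adj x z :=
  (mem_edgeNbrs.mp h).1.elim (fun h => ⟨p, .inl rfl, h⟩) fun h => ⟨q, .inr rfl, h⟩

namespace IsArcPair

variable {p q p' q' : V} {X Y : List V}

open Classical in
lemma countP_le (A : IsArcPair G C H p q X p' q' Y) (O : OffComponent G C H)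
    (hpq : G.Adj p q) (hpq' : G.Adj p' q') {F : Set V} (hF : ∀ y ∈ F, y ∉ edgeNbrs G p' q')
    (hFs : ∀ y ∈ F, ∀ z t, C ~r y :: z :: t → z ∉ edgeNbrs G p q) :
    X.countP (· ∈ edgeNbrs G p q) + X.countP (· ∈ edgeNbrs G p' q') + X.countP (· ∈ F) ≤
      X.length := by
  have hr := A.remote O hpq hpq'
  have hch : X.IsChain fun y z => z ∈ edgeNbrs G p q → y ∉ edgeNbrs G p' q' ∧ y ∉ F := by
    rw [List.isChain_iff_forall_rel_of_append_cons_cons]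
    intro y z l₁ l₂ hX hz
    refine ⟨fun hy => ?_, fun hy => hFs y hy z (l₂ ++ Y ++ l₁) ?_ hz⟩
    · obtain ⟨x, hx, hxz⟩ := exists_adj_of_mem_edgeNbrs hz
      obtain ⟨x', hx', hxy⟩ := exists_adj_of_mem_edgeNbrs hy
      refine A.no_shifted_neighbor O hr.2.2.2.1 hX hx hx' hxz hxy ?_
      rintro rfl
      rcases hx' with rfl | rfl
      · exact hr.2.2.2.2.1 hxy.symm
      · exact hr.2.2.2.2.2.1 hxy.symm
    · refine A.rot.trans ?_
      rw [hX]
      simpa using List.isRotated_append (l := l₁) (l' := y :: z :: (l₂ ++ Y))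
  obtain ⟨t, rfl, -⟩ := A.start
  exact countP_add_countP_add_countP_le (fun y _ => hF y) hch fun h => (mem_edgeNbrs.mp h).2.1 rfl

open Classical in
lemma countP_eq_ncard {l : List V} (hl : l.Nodup) (S : Set V) :
    l.countP (· ∈ S) = (S ∩ {x | x ∈ l}).ncard := by
  have : S ∩ {x | x ∈ l} = ((l.filter (· ∈ S)).toFinset : Set V) := by
    ext; simp [and_comm]
  rw [this, Set.ncard_coe_finset, List.toFinset_card_of_nodup (hl.filter _),
    List.countP_eq_length_filter]

/-- The marked edges of an arc pair have few neighbours, in terms of the sizes of `H` and of any set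
`F` that avoids these neighbours in a suitable way. -/
lemma edgeDeg_add_le [Fintype V] (A : IsArcPair G C H p q X p' q' Y) (O : OffComponent G C H)
    (hpq : G.Adj p q) (hpq' : G.Adj p' q') {F : Set V}
    (hp : ∀ h ∈ H, ¬ G.Adj p h) (hq : ∀ h ∈ H, ¬ G.Adj q h)
    (hp' : ∀ h ∈ H, ¬ G.Adj p' h) (hq' : ∀ h ∈ H, ¬ G.Adj q' h)
    (hF : ∀ y ∈ F, y ∉ H ∧ y ∉ edgeNbrs G p q ∧ y ∉ edgeNbrs G p' q')
    (hFs : ∀ y ∈ F, ∀ z t, C ~r y :: z :: t → z ∉ edgeNbrs G p q ∧ z ∉ edgeNbrs G p' q') :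
    edgeDeg G p q + edgeDeg G p' q' + F.ncard + H.ncard ≤ Fintype.card V := by
  classical
  have hXY := A.countP_le O hpq hpq' (fun y hy => (hF y hy).2.2) fun y hy z t h => (hFs y hy z t h).1
  have hYX := A.swap.countP_le O hpq' hpq (fun y hy => (hF y hy).2.1)
    fun y hy z t h => (hFs y hy z t h).2
  have hr := A.remote O hpq hpq'
  have hn := (O.cyclic.rotated A.rot).nodup
  set L : Set V := {x | x ∈ X ++ Y} with hL
  have hLC : ∀ z, z ∈ L ↔ z ∈ C := fun z => A.rot.mem_iff.symm
  have on : ∀ S : Set V, (S ∩ L).ncard = X.countP (· ∈ S) + Y.countP (· ∈ S) := by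
    intro S
    rw [hL, ← countP_eq_ncard hn, List.countP_append]
  have hd : ∀ S : Set V, S.ncard = (S ∩ L).ncard + (S \ L).ncard :=
    fun S => (Set.ncard_inter_add_ncard_sdiff_eq_ncard S L).symm
  have hLn : L.ncard = X.length + Y.length := by
    have := on Set.univ
    simpa using this
  have hHL : H \ L = H := by
    rw [sdiff_eq_left, Set.disjoint_left]
    exact fun z hz hzL => O.disjoint z hz ((hLC z).mp hzL)
  have hEH : ∀ z ∈ H, z ∉ edgeNbrs G p q ∧ z ∉ edgeNbrs G p' q' := fun z hz =>
    ⟨fun h => (mem_edgeNbrs.mp h).1.elim (hp z hz) (hq z hz),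
      fun h => (mem_edgeNbrs.mp h).1.elim (hp' z hz) (hq' z hz)⟩
  have hEE : Disjoint (edgeNbrs G p q \ L) (edgeNbrs G p' q' \ L) := by
    rw [Set.disjoint_left]
    rintro z ⟨hz, hzL⟩ ⟨hz', -⟩
    obtain ⟨x, hx, hxz⟩ := exists_adj_of_mem_edgeNbrs hz
    obtain ⟨x', hx', hxz'⟩ := exists_adj_of_mem_edgeNbrs hz'
    exact A.no_common_neighbor O hr.2.2.2.1 hx hx' hxz hxz' (fun h => hzL ((hLC z).mpr h))
      (fun h => (hEH z h).1 hz) (mem_edgeNbrs.mp hz).2.2 (mem_edgeNbrs.mp hz').2.2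
  have hEF : Disjoint (edgeNbrs G p q \ L ∪ edgeNbrs G p' q' \ L) (F \ L) := by
    rw [Set.disjoint_left]
    rintro z (⟨hz, -⟩ | ⟨hz, -⟩) ⟨hzF, -⟩
    · exact (hF z hzF).2.1 hz
    · exact (hF z hzF).2.2 hz
  have hEFH : Disjoint (edgeNbrs G p q \ L ∪ edgeNbrs G p' q' \ L ∪ F \ L) (H \ L) := by
    rw [Set.disjoint_left]
    rintro z ((⟨hz, -⟩ | ⟨hz, -⟩) | ⟨hz, -⟩) ⟨hzH, -⟩
    · exact (hEH z hzH).1 hz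
    · exact (hEH z hzH).2 hz
    · exact (hF z hz).1 hzH
  have hoff : (edgeNbrs G p q \ L).ncard + (edgeNbrs G p' q' \ L).ncard + (F \ L).ncard +
      (H \ L).ncard ≤ Lᶜ.ncard := by
    rw [← Set.ncard_union_eq hEE, ← Set.ncard_union_eq hEF, ← Set.ncard_union_eq hEFH]
    refine Set.ncard_le_ncard ?_
    rintro z (((h | h) | h) | h) <;> exact h.2
  have hcompl := Set.ncard_add_ncard_compl L
  rw [Nat.card_eq_fintype_card] at hcompl
  have h1 := hd (edgeNbrs G p q)
  have h2 := hd (edgeNbrs G p' q')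
  have h3 := hd F
  rw [on] at h1 h2 h3
  rw [hHL] at hoff
  change (edgeNbrs G p q).ncard + (edgeNbrs G p' q').ncard + F.ncard + H.ncard ≤ Fintype.card V
  omega

end IsArcPair

lemma mem_of_reachable {α : Type*} {K : SimpleGraph α} {s : Set α}
    (hs : ∀ x ∈ s, ∀ y, K.Adj x y → y ∈ s) {x y : α} (h : K.Reachable x y) (hx : x ∈ s) : y ∈ s := by
  obtain ⟨w⟩ := h
  induction w with
  | nil => exact hx
  | cons h _ ih => exact ih (hs _ hx _ h)

lemma exists_isCyclicList_of_kConnected [Fintype V] {k : ℕ} (hk : 2 ≤ k) (hG : KConnected k G) :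
    ∃ C, IsCyclicList G C := by
  by_cases hac : G.IsAcyclic
  · exfalso
    have hconn : G.Connected := by
      have := hG.2 ∅ (by simp; omega)
      rw [Finset.coe_empty, Set.compl_empty] at this
      exact (induceUnivIso G).connected_iff.mp this
    have : Nontrivial V := Fintype.one_lt_card_iff_nontrivial.mp (by have := hG.1; omega)
    classical
    obtain ⟨v, hv⟩ := (IsTree.mk hconn hac).exists_vert_degree_one_of_nontrivial
    obtain ⟨u, hu⟩ := degree_eq_one_iff_existsUnique_adj.mp hv
    obtain ⟨w, hw⟩ : ∃ w, w ∉ ({u, v} : Finset V) := by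
      by_contra! h
      have h1 := Finset.card_le_card (Finset.subset_iff.mpr fun x _ => h x : univ ⊆ {u, v})
      have h2 := Finset.card_le_two (a := u) (b := v)
      have h3 := hG.1
      rw [Finset.card_univ] at h1
      omega
    simp only [Finset.mem_insert, Finset.mem_singleton, not_or] at hw
    have hS := hG.2 {u} (by simp; omega)
    have := mem_of_reachable (s := Subtype.val ⁻¹' {v}) ?_
      (hS.preconnected ⟨v, by simpa using hu.1.ne⟩ ⟨w, by simpa using hw.1⟩) (by simp)
    · exact hw.2 (by simpa using this)
    · rintro ⟨x, hx⟩ (rfl : x = v) ⟨y, hy⟩ hxy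
      exact absurd (hu.2 y hxy) (by simpa using hy)
  · simp only [IsAcyclic, not_forall, not_not] at hac
    obtain ⟨u, c, hc⟩ := hac
    exact exists_isCyclicList hc

namespace OffComponent

lemma exists_isArcPair (O : OffComponent G C H) {v p q v' p' q' : V}
    (hv : Attached G C H v) (h : IsMark G C v p q)
    (hv' : Attached G C H v') (h' : IsMark G C v' p' q') (hne : v ≠ v') :
    ∃ X Y, IsArcPair G C H p q X p' q' Y := by
  obtain ⟨X, Y, hr, hX, hY, hs, hs'⟩ := O.exists_arcs hv h hv' h' hne
  exact ⟨X, Y, hr, ⟨v', hX, hv'⟩, ⟨v, hY, hv⟩, hs, hs', (O.far_right hv h).1, (O.far_right hv' h').1⟩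

lemma le_ncard_attached [Fintype V] (O : OffComponent G C H) {k : ℕ} (hG : KConnected k G) {a : V}
    (ha : a ∈ H) : k ≤ {v | Attached G C H v}.ncard := by
  classical
  by_contra! hlt
  have hS := hG.2 {v | Attached G C H v}.toFinset (by rwa [← Set.ncard_eq_toFinset_card'])
  obtain ⟨p, hp, hpT⟩ : ∃ p ∈ C, ¬ Attached G C H p := by
    have h3 := O.cyclic.three_le
    obtain ⟨v, hv⟩ := List.exists_mem_of_length_pos (show 0 < C.length by omega)
    by_cases hvT : Attached G C H v
    · obtain ⟨p, q, h⟩ := exists_isMark O.cyclic hv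
      refine ⟨p, ?_, O.not_attached_left hvT h⟩
      obtain ⟨X, hX, hl, t, rfl, -⟩ := h
      exact hX.mem_iff.mpr (by simp)
    · exact ⟨v, hv, hvT⟩
  have := mem_of_reachable (s := Subtype.val ⁻¹' H) ?_
    (hS.preconnected ⟨a, by simpa using fun h => O.disjoint a ha h.1⟩ ⟨p, by simpa using hpT⟩) ha
  · exact O.disjoint p this hp
  · rintro ⟨x, hx⟩ hxH ⟨y, hy⟩ hxy
    refine (O.closed x hxH y hxy).resolve_left fun hyC => ?_
    simp only [Set.coe_toFinset, Set.mem_compl_iff, Set.mem_ofPred_eq] at hy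
    exact hy ⟨hyC, x, hxH, hxy.symm⟩

lemma edgeDeg_add_two_le [Finite V] (O : OffComponent G C H) {a b : V} (ha : a ∈ H) (hb : b ∈ H)
    (hab : G.Adj a b) : edgeDeg G a b + 2 ≤ H.ncard + {v | Attached G C H v}.ncard := by
  have h1 : edgeNbrs G a b ∪ {a, b} ⊆ H ∪ {v | Attached G C H v} := by
    rintro z (hz | rfl | rfl)
    · obtain ⟨x, hx, hxz⟩ := exists_adj_of_mem_edgeNbrs hz
      have hxH : x ∈ H := by rcases hx with rfl | rfl <;> assumption
      exact (O.closed x hxH z hxz).symm.imp id fun hzC => ⟨hzC, x, hxH, hxz.symm⟩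
    · exact .inl ha
    · exact .inl hb
  have h2 : Disjoint (edgeNbrs G a b) {a, b} := Set.disjoint_sdiff_left
  have h3 := (Set.ncard_le_ncard h1).trans (Set.ncard_union_le _ _)
  rwa [Set.ncard_union_eq h2, Set.ncard_pair hab.ne] at h3

variable {p q : V → V}

lemma remote_mark (O : OffComponent G C H) (hm : ∀ v, Attached G C H v → IsMark G C v (p v) (q v))
    {v v' : V} (hv : Attached G C H v) (hv' : Attached G C H v') (hne : v ≠ v') :
    Remote G (p v, q v) (p v', q v') := by
  obtain ⟨X, Y, A⟩ := O.exists_isArcPair hv (hm v hv) hv' (hm v' hv') hne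
  exact A.remote O ((hm v hv).adj O.cyclic) ((hm v' hv').adj O.cyclic)

lemma mark_not_mem_edgeNbrs (O : OffComponent G C H)
    (hm : ∀ v, Attached G C H v → IsMark G C v (p v) (q v)) {v v' y : V} (hv : Attached G C H v)
    (hv' : Attached G C H v') (hy : y = p v ∨ y = q v) : y ∉ edgeNbrs G (p v') (q v') := by
  intro h
  obtain ⟨h1, h2, h3⟩ := mem_edgeNbrs.mp h
  by_cases e : v = v'
  · subst e
    tauto
  · have := O.remote_mark hm hv' hv (Ne.symm e)
    obtain ⟨-, -, -, -, h4, h5, h6, h7⟩ := this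
    rcases hy with rfl | rfl <;> tauto

lemma edgeDeg_mark_add_le [Fintype V] (O : OffComponent G C H)
    (hm : ∀ v, Attached G C H v → IsMark G C v (p v) (q v)) {v v' : V} (hv : Attached G C H v)
    (hv' : Attached G C H v') (hne : v ≠ v') :
    edgeDeg G (p v) (q v) + edgeDeg G (p v') (q v') + {v | Attached G C H v}.ncard + H.ncard ≤
      Fintype.card V := by
  classical
  obtain ⟨X, Y, A⟩ := O.exists_isArcPair hv (hm v hv) hv' (hm v' hv') hne
  set f : V → V := fun l => if q l ∈ C then p l else q l with hf
  have hfe : ∀ l, f l = p l ∨ f l = q l := fun l => by simp only [hf]; split_ifs <;> simp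
  have hinj : Set.InjOn f {v | Attached G C H v} := by
    intro l hl l' hl' e
    by_contra hne
    obtain ⟨h1, h2, h3, h4, -⟩ := O.remote_mark hm hl hl' hne
    rcases hfe l with h | h <;> rcases hfe l' with h' | h' <;> rw [h, h'] at e <;> tauto
  rw [← hinj.ncard_image]
  refine A.edgeDeg_add_le O ((hm v hv).adj O.cyclic) ((hm v' hv').adj O.cyclic)
    (O.far_left hv (hm v hv)).2 (O.far_right hv (hm v hv)).2
    (O.far_left hv' (hm v' hv')).2 (O.far_right hv' (hm v' hv')).2 ?_ ?_
  · rintro _ ⟨l, hl, rfl⟩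
    refine ⟨?_, O.mark_not_mem_edgeNbrs hm hl hv (hfe l), O.mark_not_mem_edgeNbrs hm hl hv' (hfe l)⟩
    rcases hfe l with h | h <;> rw [h]
    · exact (O.far_left hl (hm l hl)).1
    · exact (O.far_right hl (hm l hl)).1
  · rintro _ ⟨l, hl, rfl⟩ z t hr
    have hlC : f l ∈ C := hr.mem_iff.mpr (by simp)
    have hqC : q l ∈ C := by
      by_contra h
      simp only [hf, h, if_false] at hlC
    have hfl : f l = p l := if_pos hqC
    obtain ⟨Z, hZ, -, s, rfl, h | ⟨-, hs⟩⟩ := hm l hl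
    · exact absurd hqC h.1
    have := eq_of_isRotated_of_head (hZ.nodup_iff.mp O.cyclic.nodup) (hZ.symm.trans hr)
      (by simp [hfl])
    have hz : z = q l := by simp_all
    exact ⟨O.mark_not_mem_edgeNbrs hm hl hv (.inr hz), O.mark_not_mem_edgeNbrs hm hl hv' (.inr hz)⟩

end OffComponent

/-- If no cycle is edge-dominating, a cycle with the fewest edges off it has an `OffComponent`. -/
lemma exists_offComponent [Finite V] {C₀ : List V} (h₀ : IsCyclicList G C₀)
    (hG : ∀ C, IsCyclicList G C → ∃ a b, a ∉ C ∧ b ∉ C ∧ G.Adj a b) :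
    ∃ C H a b, OffComponent G C H ∧ a ∈ H ∧ b ∈ H ∧ G.Adj a b := by
  let off : List V → Set (V × V) := fun C => {x | x.1 ∉ C ∧ x.2 ∉ C ∧ G.Adj x.1 x.2}
  obtain ⟨C, hC, hmin⟩ := (measure fun C => (off C).ncard).wf.has_min
    {C | IsCyclicList G C} ⟨C₀, h₀⟩
  obtain ⟨a, b, ha, hb, hab⟩ := hG C hC
  let K := G.induce {x | x ∉ C}
  let H : Set V := {x | ∃ hx : x ∉ C, K.Reachable ⟨a, ha⟩ ⟨x, hx⟩}
  have haH : a ∈ H := ⟨ha, .rfl⟩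
  have closed : ∀ h ∈ H, ∀ z, G.Adj h z → z ∈ C ∨ z ∈ H := by
    rintro h ⟨hh, hr⟩ z hz
    by_cases hzC : z ∈ C
    · exact .inl hzC
    · exact .inr ⟨hzC, hr.trans (Adj.reachable (show K.Adj ⟨h, hh⟩ ⟨z, hzC⟩ from hz))⟩
  have hbH : b ∈ H := (closed a haH b hab).resolve_left hb
  have path : ∀ h ∈ H, ∀ h' ∈ H, ∃ Q : List V, Q.Nodup ∧ Q.IsChain G.Adj ∧ Q.head? = some h ∧
      Q.getLast? = some h' ∧ ∀ x ∈ Q, x ∈ H := by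
    classical
    rintro h ⟨hh, hr⟩ h' ⟨hh', hr'⟩
    obtain ⟨w, hw⟩ := (hr.symm.trans hr').exists_isPath
    refine ⟨w.support.map Subtype.val, hw.support_nodup.map Subtype.val_injective,
      (List.isChain_map _).mpr w.isChain_adj_support, ?_, ?_, ?_⟩
    · rw [List.head?_map, List.head?_eq_some_head w.support_ne_nil]
      simp
    · rw [List.getLast?_map, List.getLast?_eq_some_getLast w.support_ne_nil]
      simp
    · intro x hx
      obtain ⟨⟨y, hy⟩, hyw, rfl⟩ := List.mem_map.mp hx
      exact ⟨hy, hr.trans (w.takeUntil _ hyw).reachable⟩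
  refine ⟨C, H, a, b, ⟨hC, fun h hh => hh.1, closed, path, ?_⟩, haH, hbH, hab⟩
  rintro C' hC' ⟨h, hhC', hhH⟩
  by_contra! hcon
  refine hmin C' hC' (Set.ncard_lt_ncard ⟨?_, fun hsub => ?_⟩)
  · rintro ⟨x, y⟩ ⟨hx, hy, hxy⟩
    exact ⟨fun hxC => hy (hcon x hxC hx y hxy), fun hyC => hx (hcon y hyC hy x hxy.symm), hxy⟩
  · obtain ⟨z, hhz, hzH⟩ : ∃ z, G.Adj h z ∧ z ∈ H := by
      by_cases e : h = a
      · exact ⟨b, e ▸ hab, hbH⟩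
      obtain ⟨Q, -, hc, hh, hl, hQ⟩ := path h hhH a haH
      match Q, hc, hh, hl, hQ with
      | [x], _, hh, hl, _ => simp_all
      | x :: y :: t, hc, hh, _, hQ =>
        obtain rfl : x = h := by simpa using hh
        exact ⟨y, (List.isChain_cons_cons.mp hc).1, hQ y (by simp)⟩
    exact (@hsub (h, z) ⟨hhH.1, hzH.1, hhz⟩).1 hhC'

lemma two_mul_sum_le {k : ℕ} (hk : 2 ≤ k) (d : Fin k → ℝ) {c : ℝ}
    (h : ∀ i j, i ≠ j → d i + d j ≤ c) : 2 * ∑ i, d i ≤ k * c := by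
  obtain ⟨m, rfl⟩ := Nat.exists_eq_add_of_le' hk
  have h1 : ∑ i, d (finRotate _ i) = ∑ i, d i := Equiv.sum_comp _ _
  have h2 : ∑ i, (d i + d (finRotate _ i)) ≤ ∑ _i : Fin (m + 2), c :=
    Finset.sum_le_sum fun i _ => h _ _ (by simp)
  rw [Finset.sum_add_distrib, h1] at h2
  simpa [two_mul] using h2

lemma OffComponent.exists_remote_edges [Fintype V] (O : OffComponent G C H) {k : ℕ} (hk : 2 ≤ k)
    (hG : KConnected k G) {a b : V} (ha : a ∈ H) (hb : b ∈ H) (hab : G.Adj a b) :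
    ∃ e : Fin (k + 1) → V × V, (∀ i, G.Adj (e i).1 (e i).2) ∧
      (∀ i j, i ≠ j → Remote G (e i) (e j)) ∧
      ∑ i, (edgeDeg G (e i).1 (e i).2 : ℝ) ≤ (1 / 2 : ℝ) * k * (Fintype.card V - k) := by
  classical
  have : ∀ v, ∃ p q, Attached G C H v → IsMark G C v p q := by
    intro v
    by_cases hv : Attached G C H v
    · obtain ⟨p, q, h⟩ := exists_isMark O.cyclic hv.1
      exact ⟨p, q, fun _ => h⟩
    · exact ⟨v, v, fun h => absurd h hv⟩
  choose p q hm using this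
  set T : Set V := {v | Attached G C H v} with hT
  have hkT : k ≤ T.ncard := O.le_ncard_attached hG ha
  obtain ⟨v⟩ : Nonempty (Fin k ↪ T) := by
    rw [Function.Embedding.nonempty_iff_card_le, Fintype.card_fin, ← Nat.card_eq_fintype_card]
    exact hkT
  have hv : ∀ i, Attached G C H (v i) := fun i => (v i).2
  have hne : ∀ i j, i ≠ j → (v i : V) ≠ v j := fun i j h e => h (v.injective (Subtype.ext e))
  refine ⟨Fin.cons (a, b) fun i => (p (v i), q (v i)), ?_, ?_, ?_⟩
  · exact Fin.cases hab fun i => (hm _ (hv i)).adj O.cyclic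
  · have hfar : ∀ x ∈ H, ∀ i, x ≠ p (v i) ∧ x ≠ q (v i) ∧ ¬ G.Adj (p (v i)) x ∧
        ¬ G.Adj (q (v i)) x := by
      intro x hx i
      obtain ⟨h1, h2⟩ := O.far_left (hv i) (hm _ (hv i))
      obtain ⟨h3, h4⟩ := O.far_right (hv i) (hm _ (hv i))
      exact ⟨fun h => h1 (h ▸ hx), fun h => h3 (h ▸ hx), h2 x hx, h4 x hx⟩
    intro i j hij
    induction i using Fin.cases with
    | zero =>
      induction j using Fin.cases with
      | zero => exact absurd rfl hij
      | succ j =>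
        obtain ⟨h1, h2, h3, h4⟩ := hfar a ha j
        obtain ⟨h5, h6, h7, h8⟩ := hfar b hb j
        exact ⟨h1, h2, h5, h6, fun h => h3 h.symm, fun h => h4 h.symm, fun h => h7 h.symm,
          fun h => h8 h.symm⟩
    | succ i =>
      induction j using Fin.cases with
      | zero =>
        obtain ⟨h1, h2, h3, h4⟩ := hfar a ha i
        obtain ⟨h5, h6, h7, h8⟩ := hfar b hb i
        exact ⟨h1.symm, h5.symm, h2.symm, h6.symm, h3, h7, h4, h8⟩
      | succ j => exact O.remote_mark hm (hv i) (hv j) (hne i j fun h => hij (h ▸ rfl))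
  · have h0 := O.edgeDeg_add_two_le ha hb hab
    have hs := two_mul_sum_le hk (fun i => (edgeDeg G (p (v i)) (q (v i)) : ℝ))
      (c := Fintype.card V - T.ncard - H.ncard) fun i j hij => by
        have := O.edgeDeg_mark_add_le hm (hv i) (hv j) (hne i j hij)
        rw [← hT] at this
        have : (_ : ℝ) ≤ _ := Nat.cast_le.mpr this
        push_cast at this
        linarith
    have hH : 2 ≤ H.ncard := by
      rw [← Set.ncard_pair hab.ne]
      exact Set.ncard_le_ncard (by rintro _ (rfl | rfl) <;> assumption)
    rw [← hT] at h0
    have h0 : ((edgeDeg G a b + 2 : ℕ) : ℝ) ≤ (H.ncard + T.ncard : ℕ) := Nat.cast_le.mpr h0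
    have hH : (2 : ℝ) ≤ H.ncard := by exact_mod_cast hH
    have hkT : (k : ℝ) ≤ T.ncard := by exact_mod_cast hkT
    have hk : (2 : ℝ) ≤ k := by exact_mod_cast hk
    push_cast at h0
    rw [Fin.sum_univ_succ]
    simp only [Fin.cons_zero, Fin.cons_succ]
    nlinarith [mul_nonneg (sub_nonneg.mpr hk) (add_nonneg (sub_nonneg.mpr hH)
      (sub_nonneg.mpr hkT))]

end EdgeDominating

/-- (Veldman) Let `G` be a `k`-connected graph (`k ≥ 2`) such that every `k + 1`
mutually remote edges `e₀, …, e_k` satisfy `∑ d(eᵢ) > k(|V(G)| - k)/2`. Then `G`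
contains an edge-dominating cycle. -/
theorem edgeDominatingCycle_of_remote_edge_degrees
    [Fintype V] (k : ℕ) (hk : 2 ≤ k) (G : SimpleGraph V)
    (hconn : KConnected k G)
    (hdeg : ∀ e : Fin (k + 1) → V × V,
      (∀ i, G.Adj (e i).1 (e i).2) →
      (∀ i j, i ≠ j → Remote G (e i) (e j)) →
      (1 / 2 : ℝ) * k * (Fintype.card V - k) < ∑ i, (edgeDeg G (e i).1 (e i).2 : ℝ)) :
    ∃ (u : V) (c : G.Walk u u), c.IsCycle ∧ IsEdgeDominating G c := by
  by_contra hno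
  have hoff : ∀ C, EdgeDominating.IsCyclicList G C → ∃ a b, a ∉ C ∧ b ∉ C ∧ G.Adj a b := by
    intro C hC
    obtain ⟨u, c, hc, hsupp⟩ := hC.exists_isCycle
    by_contra! h
    exact hno ⟨u, c, hc, fun x y hx hy => h x y (by rwa [← hsupp]) (by rwa [← hsupp])⟩
  obtain ⟨C₀, h₀⟩ := EdgeDominating.exists_isCyclicList_of_kConnected hk hconn
  obtain ⟨C, H, a, b, O, ha, hb, hab⟩ := EdgeDominating.exists_offComponent h₀ hoff
  obtain ⟨e, he, hr, hsum⟩ := O.exists_remote_edges hk hconn ha hb hab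
  exact (hdeg e he hr).not_ge hsum
end

section
/- Let G be a 2-connected finite graph. If d(e₁) + d(e₂) > |V(G)| − 4 for every pair of remote edges e₁, e₂ of G, then every longest cycle in G is an edge-dominating cycle. -/
open SimpleGraph Finset

variable {V : Type*}

/-- Some path of `G` from `u` to `v` has vertex set exactly `S`. -/
def HasPathOn (G : SimpleGraph V) (S : Finset V) (u v : V) : Prop :=
  ∃ p : G.Walk u v, p.IsPath ∧ ∀ x, x ∈ p.support ↔ x ∈ S

namespace HasPathOn

variable {G : SimpleGraph V} {S T : Finset V} {u v w t : V}

theorem singleton (G : SimpleGraph V) (u : V) : HasPathOn G {u} u u :=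
  ⟨.nil, .nil, by simp⟩

theorem symm (h : HasPathOn G S u v) : HasPathOn G S v u := by
  obtain ⟨p, hp, hS⟩ := h
  exact ⟨p.reverse, hp.reverse, by simpa using hS⟩

theorem cons (h : G.Adj u v) (hT : HasPathOn G T v w) (hu : u ∉ T) [DecidableEq V] :
    HasPathOn G (insert u T) u w := by
  obtain ⟨q, hq, hqT⟩ := hT
  refine ⟨.cons h q, hq.cons (by rwa [hqT]), fun x => ?_⟩
  simp [hqT]

theorem append [DecidableEq V] (hS : HasPathOn G S u v) (h : G.Adj v w) (hT : HasPathOn G T w t)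
    (hST : Disjoint S T) : HasPathOn G (S ∪ T) u t := by
  obtain ⟨p, hp, hpS⟩ := hS
  induction p generalizing S with
  | nil =>
    convert cons h hT (Finset.disjoint_left.mp hST (by simp [← hpS])) using 1
    ext x
    simp [← hpS]
  | @cons u u' v hadj p ih =>
    obtain ⟨hp', hu⟩ := (Walk.cons_isPath_iff _ _).mp hp
    have hS : ∀ x, x ∈ p.support ↔ x ∈ S.erase u := by
      intro x
      rw [Finset.mem_erase, ← hpS, Walk.support_cons, List.mem_cons]
      grind
    have hmem : u ∈ S := by simp [← hpS]
    have := ih h (S := S.erase u) (hST.mono_left (Finset.erase_subset _ _)) hp' hS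
    convert cons hadj this ?_ using 1
    · rw [← Finset.insert_union, Finset.insert_erase hmem]
    · simpa using Finset.disjoint_left.mp hST hmem

theorem exists_isCycle (hS : HasPathOn G S u v) (h : G.Adj v u) (hcard : 3 ≤ S.card) :
    ∃ c : G.Walk v v, c.IsCycle ∧ c.length = S.card := by
  classical
  obtain ⟨p, hp, hpS⟩ := hS
  have hlen : p.length + 1 = S.card := by
    rw [← Walk.length_support, ← List.toFinset_card_of_nodup hp.support_nodup]
    congr 1
    ext x
    simp [hpS]
  refine ⟨.cons h p, (Walk.cons_isCycle_iff _ _).mpr ⟨hp, fun he => ?_⟩, by simpa using hlen⟩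
  have := hp.length_eq_one_of_mem_edges (Sym2.eq_swap ▸ he)
  omega

end HasPathOn

/-- There is a path between a neighbour of `u` and a neighbour of `v` that avoids the set `C`
and has at least two vertices. -/
def LinkedOutside (G : SimpleGraph V) (C : Set V) (u v : V) : Prop :=
  ∃ (T : Finset V) (h k : V), HasPathOn G T h k ∧ G.Adj u h ∧ G.Adj k v ∧ 2 ≤ T.card ∧
    ∀ x ∈ T, x ∉ C

theorem LinkedOutside.symm {G : SimpleGraph V} {C : Set V} {u v : V}
    (h : LinkedOutside G C u v) : LinkedOutside G C v u := by
  obtain ⟨T, a, b, hT, ha, hb, hcard, hC⟩ := h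
  exact ⟨T, b, a, hT.symm, hb.symm, ha.symm, hcard, hC⟩

/-- `f` lists, in cyclic order, the `n` vertices of a longest cycle of `G`. -/
structure IsLongestCycleEnum (G : SimpleGraph V) (n : ℕ) (f : ℕ → V) : Prop where
  three_le : 3 ≤ n
  injOn : Set.InjOn f (Set.Iio n)
  adj_succ : ∀ i, i + 1 < n → G.Adj (f i) (f (i + 1))
  adj_last : G.Adj (f (n - 1)) (f 0)
  length_le : ∀ (w : V) (c : G.Walk w w), c.IsCycle → c.length ≤ n

namespace IsLongestCycleEnum

variable {G : SimpleGraph V} {n s : ℕ} {f : ℕ → V}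

theorem hasPathOn_Icc [DecidableEq V] (hf : IsLongestCycleEnum G n f) {i j : ℕ} (hij : i ≤ j)
    (hj : j < n) : HasPathOn G ((Icc i j).image f) (f i) (f j) := by
  induction j, hij using Nat.le_induction with
  | base => simpa using HasPathOn.singleton G (f i)
  | succ j hij ih =>
    have hnot : f (j + 1) ∉ (Icc i j).image f := by
      intro hmem
      obtain ⟨k, hk, hkj⟩ := Finset.mem_image.mp hmem
      rw [Finset.mem_Icc] at hk
      have := hf.injOn (show k < n by omega) hj hkj
      omega
    have := HasPathOn.cons (hf.adj_succ j hj).symm (ih (by omega)).symm hnot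
    rw [← Finset.image_insert, Finset.insert_Icc_right_eq_Icc_add_one (by omega)] at this
    exact this.symm

theorem append [DecidableEq V] (hf : IsLongestCycleEnum G n f) {I J : Finset ℕ} {u v w t : V}
    (hI : HasPathOn G (I.image f) u v) (h : G.Adj v w) (hJ : HasPathOn G (J.image f) w t)
    (hIJ : Disjoint I J) (hIn : ∀ i ∈ I, i < n) (hJn : ∀ i ∈ J, i < n) :
    HasPathOn G ((I ∪ J).image f) u t := by
  rw [Finset.image_union]
  refine hI.append h hJ (Finset.disjoint_left.mpr fun x hx hx' => ?_)
  obtain ⟨i, hi, rfl⟩ := Finset.mem_image.mp hx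
  obtain ⟨j, hj, hji⟩ := Finset.mem_image.mp hx'
  exact Finset.disjoint_left.mp hIJ hi (hf.injOn (hJn j hj) (hIn i hi) hji ▸ hj)

/-- A path on vertices of the cycle whose ends are linked outside the cycle misses at least two
vertices of the cycle. -/
theorem card_add_two_le [DecidableEq V] (hf : IsLongestCycleEnum G n f) {I : Finset ℕ} {u v : V}
    (hI : HasPathOn G (I.image f) u v) (hIn : ∀ i ∈ I, i < n)
    (hlink : LinkedOutside G (f '' Set.Iio n) u v) : I.card + 2 ≤ n := by
  obtain ⟨T, h, k, hT, hu, hv, hcard, hC⟩ := hlink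
  have hdisj : Disjoint (I.image f) T := by
    refine Finset.disjoint_left.mpr fun x hx hx' => hC x hx' ?_
    obtain ⟨i, hi, rfl⟩ := Finset.mem_image.mp hx
    exact ⟨i, hIn i hi, rfl⟩
  have hpath := hI.append hv.symm hT.symm hdisj
  have hcardI : (I.image f).card = I.card :=
    Finset.card_image_of_injOn (hf.injOn.mono fun i hi => hIn i hi)
  have hne : 1 ≤ I.card := by
    obtain ⟨p, -, hp⟩ := hI
    have : u ∈ I.image f := (hp u).mp p.start_mem_support
    obtain ⟨i, hi, -⟩ := Finset.mem_image.mp this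
    exact Finset.card_pos.mpr ⟨i, hi⟩
  have hunion := Finset.card_union_of_disjoint hdisj
  obtain ⟨c, hc, hlen⟩ := hpath.exists_isCycle hu.symm (by omega)
  have := hf.length_le _ c hc
  omega

theorem three_le_sub_of_linked (hf : IsLongestCycleEnum G n f) {k l : ℕ} (hkl : k < l)
    (hl : l < n) (h : LinkedOutside G (f '' Set.Iio n) (f k) (f l)) : k + 3 ≤ l := by
  classical
  have hpath := hf.append (hf.hasPathOn_Icc (show l ≤ n - 1 by omega) (by omega)) hf.adj_last
    (hf.hasPathOn_Icc (show 0 ≤ k by omega) (by omega))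
    (Finset.disjoint_left.mpr fun x => by simp only [Finset.mem_Icc]; omega)
    (fun x => by simp only [Finset.mem_Icc]; omega)
    (fun x => by simp only [Finset.mem_Icc]; omega)
  have hcard := hf.card_add_two_le hpath
    (fun x => by simp only [Finset.mem_union, Finset.mem_Icc]; omega) h.symm
  rw [Finset.card_union_of_disjoint
    (Finset.disjoint_left.mpr fun x => by simp only [Finset.mem_Icc]; omega)] at hcard
  simp only [Nat.card_Icc] at hcard
  omega

/-- If the last vertex is linked to `f k`, then the successor of `f k` is adjacent neither to
`f 0` nor to `f 1`. -/
theorem not_adj_succ_of_linked_last (hf : IsLongestCycleEnum G n f) {k e : ℕ} (he : e ≤ 1)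
    (hek : e ≤ k) (hk : k + 1 < n)
    (h : LinkedOutside G (f '' Set.Iio n) (f k) (f (n - 1))) :
    ¬ G.Adj (f e) (f (k + 1)) := by
  classical
  intro hadj
  have hpath := hf.append (hf.hasPathOn_Icc (show k + 1 ≤ n - 1 by omega) (by omega)).symm
    hadj.symm (hf.hasPathOn_Icc hek (by omega))
    (Finset.disjoint_left.mpr fun x => by simp only [Finset.mem_Icc]; omega)
    (fun x => by simp only [Finset.mem_Icc]; omega)
    (fun x => by simp only [Finset.mem_Icc]; omega)
  have hcard := hf.card_add_two_le hpath
    (fun x => by simp only [Finset.mem_union, Finset.mem_Icc]; omega) h.symm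
  rw [Finset.card_union_of_disjoint
    (Finset.disjoint_left.mpr fun x => by simp only [Finset.mem_Icc]; omega)] at hcard
  simp only [Nat.card_Icc] at hcard
  omega

/-- If `f s` is linked to a later `f k`, then the predecessor of `f k` is adjacent to neither of
the two vertices before `f s`. -/
theorem not_adj_pred_of_linked (hf : IsLongestCycleEnum G n f) {k j : ℕ} (hj : j < s)
    (hjs : s ≤ j + 2) (hsk : s < k) (hk : k < n)
    (h : LinkedOutside G (f '' Set.Iio n) (f s) (f k)) :
    ¬ G.Adj (f j) (f (k - 1)) := by
  classical
  intro hadj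
  have hpath := hf.append (hf.append
    (hf.hasPathOn_Icc (show k ≤ n - 1 by omega) (by omega)) hf.adj_last
    (hf.hasPathOn_Icc (show 0 ≤ j by omega) (by omega))
    (Finset.disjoint_left.mpr fun x => by simp only [Finset.mem_Icc]; omega)
    (fun x => by simp only [Finset.mem_Icc]; omega)
    (fun x => by simp only [Finset.mem_Icc]; omega)) hadj
    (hf.hasPathOn_Icc (show s ≤ k - 1 by omega) (by omega)).symm
    (Finset.disjoint_left.mpr fun x => by simp only [Finset.mem_union, Finset.mem_Icc]; omega)
    (fun x => by simp only [Finset.mem_union, Finset.mem_Icc]; omega)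
    (fun x => by simp only [Finset.mem_Icc]; omega)
  have hcard := hf.card_add_two_le hpath
    (fun x => by simp only [Finset.mem_union, Finset.mem_Icc]; omega) h.symm
  rw [Finset.card_union_of_disjoint
      (Finset.disjoint_left.mpr fun x => by simp only [Finset.mem_union, Finset.mem_Icc]; omega),
    Finset.card_union_of_disjoint
      (Finset.disjoint_left.mpr fun x => by simp only [Finset.mem_Icc]; omega)] at hcard
  simp only [Nat.card_Icc] at hcard
  omega

theorem not_adj_pred_of_adj_succ (hf : IsLongestCycleEnum G n f) {i j k l : ℕ} (hji : j < i)
    (hij : i ≤ j + 2) (hik : i ≤ k) (hkl : k < l) (hl : l < n)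
    (h : LinkedOutside G (f '' Set.Iio n) (f k) (f l)) (hadj : G.Adj (f i) (f (k + 1))) :
    ¬ G.Adj (f j) (f (l - 1)) := by
  classical
  intro hadj'
  have hkl' := hf.three_le_sub_of_linked hkl hl h
  have hpath := hf.append (hf.append (hf.append
    (hf.hasPathOn_Icc hik (by omega)).symm hadj
    (hf.hasPathOn_Icc (show k + 1 ≤ l - 1 by omega) (by omega))
    (Finset.disjoint_left.mpr fun x => by simp only [Finset.mem_Icc]; omega)
    (fun x => by simp only [Finset.mem_Icc]; omega)
    (fun x => by simp only [Finset.mem_Icc]; omega)) hadj'.symm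
    (hf.hasPathOn_Icc (show 0 ≤ j by omega) (by omega)).symm
    (Finset.disjoint_left.mpr fun x => by simp only [Finset.mem_union, Finset.mem_Icc]; omega)
    (fun x => by simp only [Finset.mem_union, Finset.mem_Icc]; omega)
    (fun x => by simp only [Finset.mem_Icc]; omega)) hf.adj_last.symm
    (hf.hasPathOn_Icc (show l ≤ n - 1 by omega) (by omega)).symm
    (Finset.disjoint_left.mpr fun x => by simp only [Finset.mem_union, Finset.mem_Icc]; omega)
    (fun x => by simp only [Finset.mem_union, Finset.mem_Icc]; omega)
    (fun x => by simp only [Finset.mem_Icc]; omega)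
  have hcard := hf.card_add_two_le hpath
    (fun x => by simp only [Finset.mem_union, Finset.mem_Icc]; omega) h
  rw [Finset.card_union_of_disjoint
      (Finset.disjoint_left.mpr fun x => by simp only [Finset.mem_union, Finset.mem_Icc]; omega),
    Finset.card_union_of_disjoint
      (Finset.disjoint_left.mpr fun x => by simp only [Finset.mem_union, Finset.mem_Icc]; omega),
    Finset.card_union_of_disjoint
      (Finset.disjoint_left.mpr fun x => by simp only [Finset.mem_Icc]; omega)] at hcard
  simp only [Nat.card_Icc] at hcard
  omega

theorem not_adj_succ_of_adj_succ (hf : IsLongestCycleEnum G n f) {i j k l : ℕ} (hji : j < i)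
    (hij : i ≤ j + 2) (hil : i ≤ l) (hlk : l < k) (hk : k + 1 < n)
    (h : LinkedOutside G (f '' Set.Iio n) (f k) (f l)) (hadj : G.Adj (f i) (f (k + 1))) :
    ¬ G.Adj (f j) (f (l + 1)) := by
  classical
  intro hadj'
  have hpath := hf.append (hf.append (hf.append
    (hf.hasPathOn_Icc hil (by omega)).symm hadj
    (hf.hasPathOn_Icc (show k + 1 ≤ n - 1 by omega) (by omega))
    (Finset.disjoint_left.mpr fun x => by simp only [Finset.mem_Icc]; omega)
    (fun x => by simp only [Finset.mem_Icc]; omega)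
    (fun x => by simp only [Finset.mem_Icc]; omega)) hf.adj_last
    (hf.hasPathOn_Icc (show 0 ≤ j by omega) (by omega))
    (Finset.disjoint_left.mpr fun x => by simp only [Finset.mem_union, Finset.mem_Icc]; omega)
    (fun x => by simp only [Finset.mem_union, Finset.mem_Icc]; omega)
    (fun x => by simp only [Finset.mem_Icc]; omega)) hadj'
    (hf.hasPathOn_Icc (show l + 1 ≤ k by omega) (by omega))
    (Finset.disjoint_left.mpr fun x => by simp only [Finset.mem_union, Finset.mem_Icc]; omega)
    (fun x => by simp only [Finset.mem_union, Finset.mem_Icc]; omega)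
    (fun x => by simp only [Finset.mem_Icc]; omega)
  have hcard := hf.card_add_two_le hpath
    (fun x => by simp only [Finset.mem_union, Finset.mem_Icc]; omega) h.symm
  rw [Finset.card_union_of_disjoint
      (Finset.disjoint_left.mpr fun x => by simp only [Finset.mem_union, Finset.mem_Icc]; omega),
    Finset.card_union_of_disjoint
      (Finset.disjoint_left.mpr fun x => by simp only [Finset.mem_union, Finset.mem_Icc]; omega),
    Finset.card_union_of_disjoint
      (Finset.disjoint_left.mpr fun x => by simp only [Finset.mem_Icc]; omega)] at hcard
  simp only [Nat.card_Icc] at hcard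
  omega

/-- Among the first `s` vertices some edge of the cycle has at least `#X + #Y` common
non-neighbours among the others, when each vertex indexed by `X` is linked to each indexed
by `Y`. -/
theorem exists_edge_nonadj (hf : IsLongestCycleEnum G n f) {X Y : Finset ℕ}
    (hX : ∀ k ∈ X, s ≤ k ∧ k < n) (hY : ∀ k ∈ Y, s ≤ k ∧ k < n) (hXY : Disjoint X Y)
    (hsY : s ∈ Y) (hnX : n - 1 ∈ X)
    (hlink : ∀ k ∈ X, ∀ l ∈ Y, LinkedOutside G (f '' Set.Iio n) (f k) (f l)) :
    ∃ j, j + 1 < s ∧ ∃ M : Finset ℕ, X.card + Y.card ≤ M.card ∧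
      ∀ m ∈ M, s ≤ m ∧ m < n ∧ ¬ G.Adj (f j) (f m) ∧ ¬ G.Adj (f (j + 1)) (f m) := by
  classical
  have hn := hf.three_le
  have hne : ∀ k ∈ X, ∀ l ∈ Y, k ≠ l := fun k hk l hl h =>
    Finset.disjoint_left.mp hXY hk (h ▸ hl)
  have hYn : ∀ l ∈ Y, l + 1 < n := fun l hl => by
    have := hY l hl
    have := hne _ hnX l hl
    omega
  have hXs : ∀ k ∈ X, s < k := fun k hk => by
    have := hX k hk
    have := hne k hk s hsY
    omega
  have hgap : ∀ k ∈ X, ∀ l ∈ Y, l < k → l + 3 ≤ k := fun k hk l hl h =>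
    hf.three_le_sub_of_linked h (hX k hk).2 (hlink k hk l hl).symm
  have hs : 2 ≤ s := by
    by_contra hs
    have hpath := hf.hasPathOn_Icc (show s ≤ n - 1 by have := hXs _ hnX; omega) (by omega)
    have := hf.card_add_two_le hpath (fun x => by simp only [Finset.mem_Icc]; omega)
      (hlink _ hnX s hsY).symm
    simp only [Nat.card_Icc] at this
    omega
  have hstart : ∀ e ≤ 1, ∀ l ∈ Y, ¬ G.Adj (f e) (f (l + 1)) := fun e he l hl =>
    hf.not_adj_succ_of_linked_last he (by have := hY l hl; omega) (hYn l hl)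
      (hlink _ hnX l hl).symm
  have hend : ∀ j, j < s → s ≤ j + 2 → ∀ k ∈ X, ¬ G.Adj (f j) (f (k - 1)) :=
    fun j hj hjs k hk => hf.not_adj_pred_of_linked hj hjs (hXs k hk) (hX k hk).2
      (hlink k hk s hsY).symm
  by_cases hex : ∃ i, i < s ∧ ∃ l ∈ Y, G.Adj (f i) (f (l + 1))
  · obtain ⟨his, l₀, hl₀, hadj⟩ := Nat.find_spec hex
    set i := Nat.find hex with hi
    have hmin : ∀ j < i, ∀ l ∈ Y, ¬ G.Adj (f j) (f (l + 1)) := fun j hj l hl h =>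
      Nat.find_min hex hj ⟨by omega, l, hl, h⟩
    have hi2 : 2 ≤ i := by
      by_contra h
      exact hstart i (by omega) l₀ hl₀ hadj
    have hXi : ∀ j, j < i → i ≤ j + 2 → ∀ k ∈ X,
        ¬ G.Adj (f j) (f (if l₀ < k then k - 1 else k + 1)) := by
      intro j hj hij k hk
      have hk' := hX k hk
      have := hY l₀ hl₀
      split_ifs with h
      · exact hf.not_adj_pred_of_adj_succ hj hij (by omega) h hk'.2 (hlink k hk l₀ hl₀).symm hadj
      · have := hne k hk l₀ hl₀
        exact hf.not_adj_succ_of_adj_succ hj hij (by omega) (by omega) (hYn l₀ hl₀)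
          (hlink k hk l₀ hl₀).symm hadj
    refine ⟨i - 2, by omega, X.image (fun k => if l₀ < k then k - 1 else k + 1) ∪
      Y.image (· + 1), ?_, ?_⟩
    · rw [Finset.card_union_of_disjoint, Finset.card_image_of_injOn, Finset.card_image_of_injOn]
      · intro a _ b _ hab
        simpa using hab
      · intro a ha b hb hab
        have := hgap a ha l₀ hl₀
        have := hgap b hb l₀ hl₀
        simp only at hab
        split_ifs at hab <;> omega
      · refine Finset.disjoint_left.mpr fun m hm hm' => ?_
        obtain ⟨k, hk, rfl⟩ := Finset.mem_image.mp hm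
        obtain ⟨l, hl, hlk⟩ := Finset.mem_image.mp hm'
        have := hgap k hk l hl
        have := hne k hk l hl
        split_ifs at hlk <;> omega
    · intro m hm
      rcases Finset.mem_union.mp hm with hm | hm
      · obtain ⟨k, hk, rfl⟩ := Finset.mem_image.mp hm
        have := hX k hk
        have := hXs k hk
        have := hYn l₀ hl₀
        have := hne k hk l₀ hl₀
        refine ⟨?_, ?_, hXi _ (by omega) (by omega) k hk, hXi _ (by omega) (by omega) k hk⟩ <;>
          split_ifs <;> omega
      · obtain ⟨l, hl, rfl⟩ := Finset.mem_image.mp hm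
        have := hY l hl
        exact ⟨by omega, hYn l hl, hmin _ (by omega) l hl, hmin _ (by omega) l hl⟩
  · push Not at hex
    refine ⟨s - 2, by omega, X.image (· - 1) ∪ Y.image (· + 1), ?_, ?_⟩
    · rw [Finset.card_union_of_disjoint, Finset.card_image_of_injOn, Finset.card_image_of_injOn]
      · intro a _ b _ hab
        simpa using hab
      · intro a ha b hb hab
        have := hXs a ha
        have := hXs b hb
        simp only at hab
        omega
      · refine Finset.disjoint_left.mpr fun m hm hm' => ?_
        obtain ⟨k, hk, rfl⟩ := Finset.mem_image.mp hm
        obtain ⟨l, hl, hlk⟩ := Finset.mem_image.mp hm'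
        have := hgap k hk l hl
        have := hne k hk l hl
        omega
    · intro m hm
      rcases Finset.mem_union.mp hm with hm | hm
      · obtain ⟨k, hk, rfl⟩ := Finset.mem_image.mp hm
        have := hX k hk
        have := hXs k hk
        exact ⟨by omega, by omega, hend _ (by omega) (by omega) k hk,
          hend _ (by omega) (by omega) k hk⟩
      · obtain ⟨l, hl, rfl⟩ := Finset.mem_image.mp hm
        have := hY l hl
        exact ⟨by omega, hYn l hl, hex _ (by omega) l hl, hex _ (by omega) l hl⟩

end IsLongestCycleEnum

section Rotation

variable {G : SimpleGraph V} {u : V} {c : G.Walk u u}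

theorem SimpleGraph.Walk.adj_getVert_mod_length (c : G.Walk u u) (hc : 0 < c.length) (k : ℕ) :
    G.Adj (c.getVert (k % c.length)) (c.getVert ((k + 1) % c.length)) := by
  have hk := Nat.mod_lt k hc
  have hadj := c.adj_getVert_succ hk
  rcases (show k % c.length + 1 ≤ c.length from hk).eq_or_lt with h | h
  · have h0 : (k + 1) % c.length = 0 := by
      rw [← Nat.mod_add_mod, h, Nat.mod_self]
    rw [h0, Walk.getVert_zero]
    rwa [h, Walk.getVert_length] at hadj
  · rwa [← Nat.mod_add_mod, Nat.mod_eq_of_lt h]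

theorem SimpleGraph.Walk.IsCycle.isLongestCycleEnum (hc : c.IsCycle)
    (hlongest : ∀ (w : V) (c' : G.Walk w w), c'.IsCycle → c'.length ≤ c.length) (d : ℕ) :
    IsLongestCycleEnum G c.length (fun i => c.getVert ((d + i) % c.length)) := by
  have hn := hc.three_le_length
  have hpos : 0 < c.length := by omega
  refine ⟨hn, fun i hi j hj hij => ?_, fun i _ => c.adj_getVert_mod_length hpos (d + i), ?_,
    hlongest⟩
  · have hlt := fun k => Nat.mod_lt k hpos
    have := hc.getVert_injOn' (by have := hlt (d + i); simp only [Set.mem_ofPred_eq]; omega)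
      (by have := hlt (d + j); simp only [Set.mem_ofPred_eq]; omega) hij
    exact (Nat.ModEq.add_left_cancel' d this).eq_of_lt_of_lt hi hj
  · have := c.adj_getVert_mod_length hpos (d + (c.length - 1))
    rwa [show d + (c.length - 1) + 1 = d + 0 + c.length by omega, Nat.add_mod_right] at this

theorem SimpleGraph.Walk.mem_support_iff_exists_getVert_mod (hpos : 0 < c.length) (d : ℕ) {x : V} :
    x ∈ c.support ↔ ∃ i < c.length, c.getVert ((d + i) % c.length) = x := by
  refine ⟨fun h => ?_, fun ⟨i, _, h⟩ => h ▸ c.getVert_mem_support _⟩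
  obtain ⟨k, rfl, hk⟩ := Walk.mem_support_iff_exists_getVert.mp h
  have hk' : c.getVert k = c.getVert (k % c.length) := by
    rcases hk.eq_or_lt with rfl | hk
    · simp
    · rw [Nat.mod_eq_of_lt hk]
  refine ⟨(k + c.length * d - d) % c.length, Nat.mod_lt _ hpos, ?_⟩
  have : d ≤ c.length * d := Nat.le_mul_of_pos_left d hpos
  rw [hk', Nat.add_mod_mod, show d + (k + c.length * d - d) = k + c.length * d by omega,
    Nat.add_mul_mod_self_left]

/-- Given two nonempty sets of vertices of a cycle, some rotation of the cycle ends in `X` and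
reaches `X ∪ Y` for the first time in `Y`. -/
theorem SimpleGraph.Walk.exists_rotation (hpos : 0 < c.length) {X Y : Finset V}
    (hX : X.Nonempty) (hY : Y.Nonempty) (hXc : ∀ x ∈ X, x ∈ c.support)
    (hYc : ∀ x ∈ Y, x ∈ c.support) :
    ∃ d, ∃ s < c.length, c.getVert ((d + s) % c.length) ∈ Y ∧
      c.getVert ((d + (c.length - 1)) % c.length) ∈ X ∧
      ∀ i < s, c.getVert ((d + i) % c.length) ∉ X ∧ c.getVert ((d + i) % c.length) ∉ Y := by
  classical
  obtain ⟨x, hx⟩ := hX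
  obtain ⟨y, hy⟩ := hY
  obtain ⟨k₀, hk₀, rfl⟩ := (c.mem_support_iff_exists_getVert_mod hpos 0).mp (hXc x hx)
  obtain ⟨l, hl, rfl⟩ := (c.mem_support_iff_exists_getVert_mod hpos 0).mp (hYc y hy)
  simp only [zero_add] at hx hy
  have hex : ∃ m, k₀ < m ∧ c.getVert (m % c.length) ∈ Y :=
    ⟨l + c.length, by omega, by rwa [Nat.add_mod_right]⟩
  obtain ⟨m, hm, hmin⟩ : ∃ m, (k₀ < m ∧ c.getVert (m % c.length) ∈ Y) ∧
      ∀ i < m, ¬ (k₀ < i ∧ c.getVert (i % c.length) ∈ Y) :=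
    ⟨Nat.find hex, Nat.find_spec hex, fun i hi => Nat.find_min hex hi⟩
  set k := Nat.findGreatest (fun k => c.getVert (k % c.length) ∈ X) (m - 1) with hk
  have hkX : c.getVert (k % c.length) ∈ X :=
    Nat.findGreatest_spec (P := fun k => c.getVert (k % c.length) ∈ X) (m := k₀) (by omega) hx
  have hk₀k : k₀ ≤ k := Nat.le_findGreatest (by omega) hx
  have hkm : k ≤ m - 1 := Nat.findGreatest_le _
  refine ⟨k + 1, m - (k + 1), ?_, ?_, ?_, fun i hi => ⟨?_, ?_⟩⟩
  · by_contra h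
    refine hmin (m - c.length) (by omega) ⟨by omega, ?_⟩
    rw [← Nat.add_mod_right, Nat.sub_add_cancel (by omega)]
    exact hm.2
  · rw [Nat.add_sub_cancel' (by omega)]
    exact hm.2
  · rwa [show k + 1 + (c.length - 1) = k + c.length by omega, Nat.add_mod_right]
  · exact Nat.findGreatest_is_greatest (P := fun k => c.getVert (k % c.length) ∈ X)
      (n := m - 1) (by omega) (by omega)
  · exact fun h => hmin (k + 1 + i) (by omega) ⟨by omega, h⟩

end Rotation

theorem KConnected.exists_adj_boundary [Fintype V] {G : SimpleGraph V} (hconn : KConnected 2 G)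
    {S : Finset V} (hS : S.card < 2) {K : Set V} {a b : V} (ha : a ∈ K) (haS : a ∉ S)
    (hb : b ∉ K) (hbS : b ∉ S) :
    ∃ u v, u ∈ K ∧ u ∉ S ∧ v ∉ K ∧ v ∉ S ∧ G.Adj u v := by
  obtain ⟨p⟩ := (hconn.2 S hS).preconnected ⟨a, by simpa using haS⟩ ⟨b, by simpa using hbS⟩
  obtain ⟨d, -, hd₁, hd₂⟩ := p.exists_boundary_dart (Subtype.val ⁻¹' K) ha hb
  exact ⟨d.fst, d.snd, hd₁, fun h => d.fst.2 (Finset.mem_coe.mpr h), hd₂,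
    fun h => d.snd.2 (Finset.mem_coe.mpr h), d.adj⟩

/-- If `A` has at least two vertices, each with a neighbour in `H`, and at least two vertices of `H`
have a neighbour in `A`, then `A` splits into two nonempty parts such that any two vertices from
different parts have distinct neighbours in `H`. -/
theorem exists_partition_distinct_neighbors (G : SimpleGraph V) {H : Set V} {A : Finset V}
    (hA : ∀ z ∈ A, ∃ h ∈ H, G.Adj z h) {h₁ h₂ c₁ c₂ c₃ : V} (hh₁ : h₁ ∈ H) (hh₂ : h₂ ∈ H)
    (hne : h₁ ≠ h₂) (hc₁ : c₁ ∈ A) (hc₂ : c₂ ∈ A) (hcne : c₂ ≠ c₁) (hc₃ : c₃ ∈ A)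
    (hadj₁ : G.Adj c₁ h₁) (hadj₃ : G.Adj c₃ h₂) :
    ∃ X Y : Finset V, X.Nonempty ∧ Y.Nonempty ∧ Disjoint X Y ∧ (∀ z, z ∈ A ↔ z ∈ X ∨ z ∈ Y) ∧
      ∀ z ∈ X, ∀ w ∈ Y, ∃ h ∈ H, ∃ h' ∈ H, h ≠ h' ∧ G.Adj z h ∧ G.Adj w h' := by
  classical
  have hsplit : ∀ h ∈ H, ∀ c ∈ A, G.Adj c h → (∃ w ∈ A, ¬ G.Adj w h) →
      ∃ X Y : Finset V, X.Nonempty ∧ Y.Nonempty ∧ Disjoint X Y ∧ (∀ z, z ∈ A ↔ z ∈ X ∨ z ∈ Y) ∧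
        ∀ z ∈ X, ∀ w ∈ Y, ∃ h ∈ H, ∃ h' ∈ H, h ≠ h' ∧ G.Adj z h ∧ G.Adj w h' := by
    rintro h hh c hc hch ⟨w, hw, hwh⟩
    refine ⟨A.filter (G.Adj · h), A.filter (¬ G.Adj · h), ⟨c, by simp [hc, hch]⟩,
      ⟨w, by simp [hw, hwh]⟩, Finset.disjoint_filter_filter_not _ _ _, fun z => ?_,
      fun z hz w hw => ?_⟩
    · simp only [Finset.mem_filter]
      tauto
    · rw [Finset.mem_filter] at hz hw
      obtain ⟨h', hh', hwh'⟩ := hA w hw.1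
      exact ⟨h, hh, h', hh', fun e => hw.2 (e ▸ hwh'), hz.2, hwh'⟩
  by_cases H₁ : ∃ w ∈ A, ¬ G.Adj w h₁
  · exact hsplit h₁ hh₁ c₁ hc₁ hadj₁ H₁
  by_cases H₂ : ∃ w ∈ A, ¬ G.Adj w h₂
  · exact hsplit h₂ hh₂ c₃ hc₃ hadj₃ H₂
  push Not at H₂
  refine ⟨{c₁}, A.erase c₁, by simp, ⟨c₂, by simp [hc₂, hcne]⟩, by simp, fun z => ?_,
    fun z hz w hw => ⟨h₁, hh₁, h₂, hh₂, hne, ?_, H₂ w (Finset.mem_of_mem_erase hw)⟩⟩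
  · by_cases h : z = c₁ <;> simp [h, hc₁]
  · rwa [Finset.mem_singleton.mp hz]

/-- The vertices that can be reached from `x` by a walk avoiding `C`. -/
def reachAvoiding (G : SimpleGraph V) (C : Set V) (x : V) : Set V :=
  {v | ∃ p : G.Walk x v, ∀ t ∈ p.support, t ∉ C}

section ReachAvoiding

variable {G : SimpleGraph V} {C : Set V} {x v w : V}

theorem notMem_of_mem_reachAvoiding (hv : v ∈ reachAvoiding G C x) : v ∉ C := by
  obtain ⟨p, hp⟩ := hv
  exact hp v p.end_mem_support

theorem mem_reachAvoiding_self (hx : x ∉ C) : x ∈ reachAvoiding G C x :=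
  ⟨.nil, by simpa using hx⟩

theorem mem_reachAvoiding_of_adj (hv : v ∈ reachAvoiding G C x) (hadj : G.Adj v w) (hw : w ∉ C) :
    w ∈ reachAvoiding G C x := by
  obtain ⟨p, hp⟩ := hv
  refine ⟨p.concat hadj, fun t ht => ?_⟩
  rw [Walk.support_concat, List.mem_append, List.mem_singleton] at ht
  rcases ht with ht | rfl
  · exact hp t ht
  · exact hw

theorem linkedOutside_of_mem_reachAvoiding {a b : V} (hv : v ∈ reachAvoiding G C x)
    (hw : w ∈ reachAvoiding G C x) (hne : v ≠ w) (hav : G.Adj a v) (hbw : G.Adj b w) :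
    LinkedOutside G C a b := by
  classical
  obtain ⟨p, hp⟩ := hv
  obtain ⟨q, hq⟩ := hw
  let r := (p.reverse.append q).bypass
  refine ⟨r.support.toFinset, v, w, ⟨r, Walk.bypass_isPath _, by simp⟩, hav, hbw.symm, ?_,
    fun t ht => ?_⟩
  · exact Finset.one_lt_card.mpr ⟨v, by simp, w, by simp, hne⟩
  · have := Walk.support_bypass_subset_support _ (List.mem_toFinset.mp ht)
    rw [Walk.mem_support_append_iff, Walk.support_reverse, List.mem_reverse] at this
    exact this.elim (hp t) (hq t)

end ReachAvoiding

/-- The neighbours on `c` of a nontrivial component of the complement of a cycle `c` split into two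
nonempty parts such that any two vertices from different parts are linked outside `c`. -/
theorem exists_linked_partition [Fintype V] {G : SimpleGraph V} (hconn : KConnected 2 G) {u : V}
    {c : G.Walk u u} (hc : c.IsCycle) {x y : V} (hxy : G.Adj x y) (hx : x ∉ c.support)
    (hy : y ∉ c.support) :
    ∃ X Y : Finset V, X.Nonempty ∧ Y.Nonempty ∧ Disjoint X Y ∧
      (∀ z, (z ∈ c.support ∧ ∃ h ∈ reachAvoiding G {v | v ∈ c.support} x, G.Adj z h) ↔
        z ∈ X ∨ z ∈ Y) ∧
      ∀ z ∈ X, ∀ w ∈ Y, LinkedOutside G {v | v ∈ c.support} z w := by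
  classical
  set C : Set V := {v | v ∈ c.support}
  set H := reachAvoiding G C x
  have hxH : x ∈ H := mem_reachAvoiding_self hx
  have hyH : y ∈ H := mem_reachAvoiding_of_adj hxH hxy hy
  have hHC : ∀ h ∈ C, h ∉ H := fun h hC hh => notMem_of_mem_reachAvoiding hh hC
  have hboundary : ∀ S : Finset V, S.card < 2 → (∃ h ∈ H, h ∉ S) → (∃ z ∈ C, z ∉ S) →
      ∃ h ∈ H, h ∉ S ∧ ∃ z ∈ C, z ∉ S ∧ G.Adj z h := by
    rintro S hS ⟨h, hh, hhS⟩ ⟨z, hz, hzS⟩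
    obtain ⟨a, b, ha, haS, hb, hbS, hab⟩ :=
      hconn.exists_adj_boundary hS hh hhS (hHC z hz) hzS
    exact ⟨a, ha, haS, b, by_contra fun hbC => hb (mem_reachAvoiding_of_adj ha hab hbC), hbS,
      hab.symm⟩
  have huC : u ∈ C := c.start_mem_support
  obtain ⟨h₁, hh₁, -, c₁, hc₁, -, hadj₁⟩ := hboundary ∅ (by simp) ⟨x, hxH, by simp⟩
    ⟨u, huC, by simp⟩
  have hother : ∃ z ∈ C, z ∉ ({c₁} : Finset V) := by
    have hsnd : c.snd ∈ C := c.getVert_mem_support 1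
    have : G.Adj u c.snd := c.adj_snd hc.not_nil
    by_cases h : u = c₁
    · exact ⟨c.snd, hsnd, by simpa [← h] using this.ne'⟩
    · exact ⟨u, huC, by simpa using h⟩
  have hother' : ∃ h ∈ H, h ∉ ({h₁} : Finset V) := by
    by_cases h : x = h₁
    · exact ⟨y, hyH, by simpa [← h] using hxy.ne'⟩
    · exact ⟨x, hxH, by simpa using h⟩
  obtain ⟨h₀, hh₀, -, c₂, hc₂, hcne, hadj₂⟩ := hboundary {c₁} (by simp)
    ⟨x, hxH, fun h => hHC c₁ hc₁ (Finset.mem_singleton.mp h ▸ hxH)⟩ hother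
  obtain ⟨h₂, hh₂, hne, c₃, hc₃, -, hadj₃⟩ := hboundary {h₁} (by simp) hother'
    ⟨u, huC, fun h => hHC u huC (Finset.mem_singleton.mp h ▸ hh₁)⟩
  have hmem : ∀ z, z ∈ Finset.univ.filter (fun z => z ∈ C ∧ ∃ h ∈ H, G.Adj z h) ↔
      z ∈ C ∧ ∃ h ∈ H, G.Adj z h := by simp
  obtain ⟨X, Y, hX, hY, hXY, hA, hlink⟩ := exists_partition_distinct_neighbors G
    (fun z hz => ((hmem z).mp hz).2) hh₁ hh₂ (fun e => hne (by simp [e]))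
    ((hmem c₁).mpr ⟨hc₁, h₁, hh₁, hadj₁⟩) ((hmem c₂).mpr ⟨hc₂, h₀, hh₀, hadj₂⟩)
    (by simpa using hcne) ((hmem c₃).mpr ⟨hc₃, h₂, hh₂, hadj₃⟩) hadj₁ hadj₃
  refine ⟨X, Y, hX, hY, hXY, fun z => (hmem z).symm.trans (hA z), fun z hz w hw => ?_⟩
  obtain ⟨h, hh, h', hh', hne', hzh, hwh'⟩ := hlink z hz w hw
  exact linkedOutside_of_mem_reachAvoiding hh hh' hne' hzh hwh'

/-- If `G` is 2-connected and `d(e₁) + d(e₂) > |V(G)| - 4` for every pair of remote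
edges, then every longest cycle in `G` is edge-dominating. -/
theorem longest_cycle_edgeDominating_of_remote_edge_degrees
    [Fintype V] (G : SimpleGraph V)
    (hconn : KConnected 2 G)
    (hdeg : ∀ e₁ e₂ : V × V, G.Adj e₁.1 e₁.2 → G.Adj e₂.1 e₂.2 → Remote G e₁ e₂ →
      (Fintype.card V : ℤ) - 4 < (edgeDeg G e₁.1 e₁.2 : ℤ) + (edgeDeg G e₂.1 e₂.2 : ℤ))
    (u : V) (c : G.Walk u u) (hc : c.IsCycle)
    (hlongest : ∀ (w : V) (c' : G.Walk w w), c'.IsCycle → c'.length ≤ c.length) :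
    IsEdgeDominating G c := by
  
  classical
  intro x y hx hy hxy
  have hn3 : 3 ≤ c.length := hc.three_le_length
  have hpos : 0 < c.length := by omega
  set C : Set V := {v | v ∈ c.support}
  obtain ⟨X, Y, hX, hY, hXY, hA, hlink⟩ := exists_linked_partition hconn hc hxy hx hy
  set H := reachAvoiding G C x
  have hxH : x ∈ H := mem_reachAvoiding_self hx
  have hyH : y ∈ H := mem_reachAvoiding_of_adj hxH hxy hy
  have hXc : ∀ z ∈ X, z ∈ C := fun z hz => ((hA z).mpr (.inl hz)).1
  have hYc : ∀ z ∈ Y, z ∈ C := fun z hz => ((hA z).mpr (.inr hz)).1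
  obtain ⟨d, s, hs, hsY, hlX, hgap⟩ :=
    SimpleGraph.Walk.exists_rotation (c := c) hpos hX hY hXc hYc
  have hf := hc.isLongestCycleEnum hlongest d
  have himage := fun z => c.mem_support_iff_exists_getVert_mod (x := z) hpos d
  set f := fun i => c.getVert ((d + i) % c.length)
  have hCf : C = f '' Set.Iio c.length := by
    ext z
    exact himage z
  have hpull : ∀ Z : Finset V, (∀ z ∈ Z, z ∈ C) → (∀ i < s, f i ∉ Z) →
      ((Finset.Ico s c.length).filter (f · ∈ Z)).card = Z.card := by
    intro Z hZ hZs
    refine Finset.card_bij (fun i _ => f i) (by simp) (fun i hi j hj => ?_) (fun z hz => ?_)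
    · simp only [Finset.mem_filter, Finset.mem_Ico] at hi hj
      exact hf.injOn hi.1.2 hj.1.2
    · obtain ⟨i, hi, rfl⟩ := (himage z).mp (hZ z hz)
      refine ⟨i, ?_, rfl⟩
      simp only [Finset.mem_filter, Finset.mem_Ico]
      exact ⟨⟨not_lt.mp fun h => hZs i h hz, hi⟩, hz⟩
  obtain ⟨j, hj, M, hMcard, hM⟩ := hf.exists_edge_nonadj (s := s)
    (X := (Finset.Ico s c.length).filter (f · ∈ X)) (Y := (Finset.Ico s c.length).filter (f · ∈ Y))
    (by simp +contextual) (by simp +contextual)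
    (Finset.disjoint_left.mpr fun i hi hi' => Finset.disjoint_left.mp hXY
      (Finset.mem_filter.mp hi).2 (Finset.mem_filter.mp hi').2)
    (Finset.mem_filter.mpr ⟨Finset.mem_Ico.mpr ⟨le_rfl, hs⟩, hsY⟩)
    (Finset.mem_filter.mpr ⟨Finset.mem_Ico.mpr ⟨by omega, by omega⟩, hlX⟩)
    (fun k hk l hl => by
      rw [← hCf]
      exact hlink _ (Finset.mem_filter.mp hk).2 _ (Finset.mem_filter.mp hl).2)
  rw [hpull X hXc fun i hi => (hgap i hi).1, hpull Y hYc fun i hi => (hgap i hi).2] at hMcard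
  have hfC : ∀ i, f i ∈ C := fun i => c.getVert_mem_support _
  have hfar : ∀ i < s, ∀ h ∈ H, ¬ G.Adj (f i) h := fun i hi h hh hadj =>
    ((hA (f i)).mp ⟨hfC i, h, hh, hadj⟩).elim (hgap i hi).1 (hgap i hi).2
  have hHC : ∀ h ∈ H, h ∉ C := fun h hh => notMem_of_mem_reachAvoiding hh
  have hne : ∀ i, ∀ h ∈ H, h ≠ f i := fun i h hh e => hHC h hh (e ▸ hfC i)
  have hadj : G.Adj (f j) (f (j + 1)) := hf.adj_succ j (by omega)
  have hdegsum := hdeg (x, y) (f j, f (j + 1)) hxy hadj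
    ⟨hne _ x hxH, hne _ x hxH, hne _ y hyH, hne _ y hyH,
      fun h => hfar j (by omega) x hxH h.symm, fun h => hfar (j + 1) hj x hxH h.symm,
      fun h => hfar j (by omega) y hyH h.symm, fun h => hfar (j + 1) hj y hyH h.symm⟩
  have hdeg₁ : edgeDeg G x y + 2 ≤ H.ncard + (X.card + Y.card) := by
    have hsub : (G.neighborSet x ∪ G.neighborSet y) \ {x, y} ⊆ (H \ {x, y}) ∪ ↑(X ∪ Y) := by
      rintro v ⟨hv, hvxy⟩
      by_cases hvC : v ∈ C
      · right
        rw [Finset.mem_coe, Finset.mem_union, ← hA]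
        exact hv.elim (fun h => ⟨hvC, x, hxH, h.symm⟩) fun h => ⟨hvC, y, hyH, h.symm⟩
      · exact .inl ⟨hv.elim (mem_reachAvoiding_of_adj hxH · hvC)
          (mem_reachAvoiding_of_adj hyH · hvC), hvxy⟩
    have h₁ := (Set.ncard_le_ncard hsub).trans (Set.ncard_union_le _ _)
    rw [Set.ncard_coe_finset, Finset.card_union_of_disjoint hXY] at h₁
    have h₂ := Set.ncard_sdiff_add_ncard_of_subset
      (Set.insert_subset hxH (Set.singleton_subset_iff.mpr hyH))
    rw [Set.ncard_pair hxy.ne] at h₂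
    unfold edgeDeg
    omega
  have hdeg₂ : edgeDeg G (f j) (f (j + 1)) + (H.ncard + (2 + M.card)) ≤ Fintype.card V := by
    have hcardM : (f '' ↑M).ncard = M.card := by
      rw [Set.InjOn.ncard_image (hf.injOn.mono fun i hi => (hM i hi).2.1), Set.ncard_coe_finset]
    have hdisj₁ : Disjoint ({f j, f (j + 1)} : Set V) (f '' ↑M) := by
      rw [Set.disjoint_right]
      rintro _ ⟨m, hm, rfl⟩ hmem
      have hmM := hM m hm
      rcases hmem with h | h
      · have := hf.injOn hmM.2.1 (show j < c.length by omega) h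
        omega
      · have := hf.injOn hmM.2.1 (show j + 1 < c.length by omega) h
        omega
    have hdisj₂ : Disjoint H ({f j, f (j + 1)} ∪ f '' ↑M) := by
      rw [Set.disjoint_left]
      rintro h hh ((rfl | rfl) | ⟨m, -, rfl⟩) <;> exact hne _ _ hh rfl
    have hdisj₃ : Disjoint ((G.neighborSet (f j) ∪ G.neighborSet (f (j + 1))) \
        {f j, f (j + 1)}) (H ∪ ({f j, f (j + 1)} ∪ f '' ↑M)) := by
      rw [Set.disjoint_left]
      rintro v ⟨hv, hv'⟩ (hvH | hvf | ⟨m, hm, rfl⟩)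
      · exact hv.elim (hfar j (by omega) v hvH) (hfar (j + 1) hj v hvH)
      · exact hv' hvf
      · exact hv.elim (hM m hm).2.2.1 (hM m hm).2.2.2
    rw [edgeDeg, ← hcardM, ← Set.ncard_pair hadj.ne, ← Set.ncard_union_eq hdisj₁,
      ← Set.ncard_union_eq hdisj₂, ← Set.ncard_union_eq hdisj₃, ← Nat.card_eq_fintype_card]
    exact Set.ncard_le_card _
  simp only at hdegsum
  omega
end
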